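/- arXiv:0910.0323 — 4 statements merged into one kernel-verified Lean document; each statement's English description precedes it below -/
import Mathlib

section
/- Let R > 0, M ≥ 0, and let u ∈ C²((−R,R)) satisfy u ≥ 0 on (−R,R) and |u''(x)| ≤ M for all x ∈ (−R,R). Then: (i) if M ≥ 2u(0)/R², then |u'(0)| ≤ √(2 u(0) M); (ii) if M < 2u(0)/R², then |u'(0)| ≤ u(0)/R + (R/2) M. -/
open Set

/-- A concave function lies below its tangent lines. -/
lemma ConcaveOn.le_tangent_of_hasDerivAt {S : Set ℝ} {f : ℝ → ℝ} {f' x y : ℝ}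
    (hf : ConcaveOn ℝ S f) (hx : x ∈ S) (hy : y ∈ S) (hd : HasDerivAt f f' x) :
    f y ≤ f x + f' * (y - x) := by
  rcases lt_trichotomy x y with h | rfl | h
  · have := hf.slope_le_of_hasDerivAt hx hy h hd
    rw [slope_def_field, div_le_iff₀ (sub_pos.2 h)] at this
    linarith
  · simp
  · have := hf.le_slope_of_hasDerivAt hy hx h hd
    rw [slope_def_field, le_div_iff₀ (sub_pos.2 h)] at this
    linarith

/-- Second-order Taylor upper bound on a convex open set where the second derivative is at most `M`. -/
lemma le_taylor_two_of_deriv2_le {S : Set ℝ} {u : ℝ → ℝ} {M x y : ℝ} (hS : IsOpen S)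
    (hc : Convex ℝ S) (hu : ContDiffOn ℝ 2 u S) (hM : ∀ z ∈ S, deriv (deriv u) z ≤ M)
    (hx : x ∈ S) (hy : y ∈ S) :
    u y ≤ u x + deriv u x * (y - x) + M / 2 * (y - x) ^ 2 := by
  have hu' : ContDiffOn ℝ 1 (deriv u) S :=
    ((contDiffOn_succ_iff_deriv_of_isOpen (n := 1) hS).1
      (by simpa [one_add_one_eq_two] using hu)).2.2
  have h1 : ∀ z ∈ S, HasDerivAt u (deriv u z) z := fun z hz =>
    ((hu.differentiableOn (by norm_num)).differentiableAt (hS.mem_nhds hz)).hasDerivAt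
  have h2 : ∀ z ∈ S, HasDerivAt (deriv u) (deriv (deriv u) z) z := fun z hz =>
    ((hu'.differentiableOn (by norm_num)).differentiableAt (hS.mem_nhds hz)).hasDerivAt
  have g1 : ∀ z ∈ S, HasDerivAt (fun t => u t - M / 2 * (t - x) ^ 2)
      (deriv u z - M * (z - x)) z := fun z hz => by
    refine ((h1 z hz).sub ((((hasDerivAt_id z).sub_const x).pow 2).const_mul (M / 2))).congr_deriv ?_
    simp
    ring
  have g2 : ∀ z ∈ S, HasDerivAt (fun t => deriv u t - M * (t - x))
      (deriv (deriv u) z - M) z := fun z hz => by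
    simpa using (h2 z hz).fun_sub (((hasDerivAt_id z).sub_const x).const_mul M)
  have hconc : ConcaveOn ℝ S (fun t => u t - M / 2 * (t - x) ^ 2) := by
    apply concaveOn_of_hasDerivWithinAt2_nonpos hc
      (fun z hz => (g1 z hz).continuousAt.continuousWithinAt)
      (fun z hz => (g1 z (interior_subset hz)).hasDerivWithinAt)
      (fun z hz => (g2 z (interior_subset hz)).hasDerivWithinAt)
    intro z hz
    linarith [hM z (interior_subset hz)]
  have := hconc.le_tangent_of_hasDerivAt hx hy (g1 x hx)
  simp only [sub_self, mul_zero, sub_zero, zero_pow two_ne_zero] at this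
  linarith

/-- Proposition 1: gradient bound for nonnegative `C²` functions on
`(-R, R)` with two-sided bound `|u''| ≤ M`. -/
theorem simple_inequality_two_sided (R M : ℝ) (hR : 0 < R) (hM : 0 ≤ M)
    (u : ℝ → ℝ) (hu : ContDiffOn ℝ 2 u (Ioo (-R) R))
    (hnonneg : ∀ x ∈ Ioo (-R) R, 0 ≤ u x)
    (hbound : ∀ x ∈ Ioo (-R) R, |deriv (deriv u) x| ≤ M) :
    (2 * u 0 / R ^ 2 ≤ M → |deriv u 0| ≤ Real.sqrt (2 * u 0 * M)) ∧
    (M < 2 * u 0 / R ^ 2 → |deriv u 0| ≤ u 0 / R + (R / 2) * M) := by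
  have h0 : (0 : ℝ) ∈ Ioo (-R) R := ⟨by linarith, hR⟩
  have taylor : ∀ t ∈ Ioo (-R) R, 0 ≤ u 0 + deriv u 0 * t + M / 2 * t ^ 2 := fun t ht => by
    have := le_taylor_two_of_deriv2_le isOpen_Ioo (convex_Ioo _ _) hu
      (fun z hz => (le_abs_self _).trans (hbound z hz)) h0 ht
    rw [sub_zero] at this
    exact (hnonneg t ht).trans this
  have key_Ico : ∀ s ∈ Ico 0 R, |deriv u 0| * s ≤ u 0 + M / 2 * s ^ 2 := fun s hs => by
    have h₁ := taylor s ⟨by linarith [hs.1], hs.2⟩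
    have h₂ := taylor (-s) ⟨by linarith [hs.2], by linarith [hs.1]⟩
    rcases abs_cases (deriv u 0) with h | h <;> rw [h.1] <;> linarith
  have key : ∀ s ∈ Icc 0 R, |deriv u 0| * s ≤ u 0 + M / 2 * s ^ 2 := by
    rw [← closure_Ico hR.ne]
    exact fun s hs => le_on_closure key_Ico (by fun_prop) (by fun_prop) hs
  have hend := key R ⟨hR.le, le_rfl⟩
  refine ⟨fun h => Real.le_sqrt_of_sq_le ?_, fun _ => ?_⟩
  · rw [div_le_iff₀ (by positivity)] at h
    have hp : |deriv u 0| ≤ M * R := le_of_mul_le_mul_right (by linarith) hR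
    rcases hM.eq_or_lt with rfl | hM
    · have : |deriv u 0| = 0 := le_antisymm (by simpa using hp) (abs_nonneg _)
      simp [this]
    · have := key (|deriv u 0| / M) ⟨by positivity, by rwa [div_le_iff₀' hM]⟩
      field_simp at this
      linarith
  · rw [← mul_le_mul_iff_left₀ hR]
    field_simp
    linarith
end

section
/- Let R > 0, M ≥ 0, and let u ∈ C²((−R,R)) satisfy u ≥ 0 on (−R,R) and the one-sided bound u''(x) ≤ M for all x ∈ (−R,R). Then: (i) if M ≥ 2u(0)/R², then |u'(0)| ≤ √(2 u(0) M); (ii) if M < 2u(0)/R², then |u'(0)| ≤ u(0)/R + (R/2) M. -/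
open Set

/-- Second-order upper bound: if `u'' ≤ M` on an open convex set, then `u` lies below the parabola of
second derivative `M` that is tangent to `u` at a point of the set. -/
theorem Convex.image_le_quadratic_of_deriv2_le {D : Set ℝ} (hD : Convex ℝ D) (hDo : IsOpen D)
    {u : ℝ → ℝ} (hu : ContDiffOn ℝ 2 u D) {M : ℝ} (hM : ∀ x ∈ D, deriv (deriv u) x ≤ M)
    {a b : ℝ} (ha : a ∈ D) (hb : b ∈ D) :
    u b ≤ u a + deriv u a * (b - a) + M / 2 * (b - a) ^ 2 := by
  have hu1 : DifferentiableOn ℝ u D := hu.differentiableOn (by norm_num)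
  have hu2 : DifferentiableOn ℝ (deriv u) D :=
    (hu.deriv_of_isOpen (m := 1) hDo (by norm_num)).differentiableOn (by norm_num)
  have deriv_sub_le : ∀ x ∈ D, ∀ y ∈ D, x ≤ y → deriv u y - deriv u x ≤ M * (y - x) :=
    hD.image_sub_le_mul_sub_of_deriv_le hu2.continuousOn (hu2.mono interior_subset)
      fun x hx => hM x (interior_subset hx)
  have hg : ∀ x ∈ D, HasDerivAt (fun x => u x - M / 2 * (x - a) ^ 2)
      (deriv u x - M * (x - a)) x := fun x hx => by
    have h := ((hu1 x hx).differentiableAt (hDo.mem_nhds hx)).hasDerivAt.sub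
      ((((hasDerivAt_id x).sub_const a).pow 2).const_mul (M / 2))
    refine h.congr_deriv ?_
    simp
    ring
  rcases lt_trichotomy a b with hab | rfl | hab
  · have hs : Icc a b ⊆ D := hD.ordConnected.out ha hb
    obtain ⟨c, hc, h⟩ := exists_hasDerivAt_eq_slope _ _ hab
      (fun x hx => (hg x (hs hx)).continuousAt.continuousWithinAt)
      fun x hx => hg x (hs (Ioo_subset_Icc_self hx))
    rw [eq_div_iff (sub_pos.2 hab).ne'] at h
    have := deriv_sub_le a ha c (hs (Ioo_subset_Icc_self hc)) hc.1.le
    nlinarith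
  · simp
  · have hs : Icc b a ⊆ D := hD.ordConnected.out hb ha
    obtain ⟨c, hc, h⟩ := exists_hasDerivAt_eq_slope _ _ hab
      (fun x hx => (hg x (hs hx)).continuousAt.continuousWithinAt)
      fun x hx => hg x (hs (Ioo_subset_Icc_self hx))
    rw [eq_div_iff (sub_pos.2 hab).ne'] at h
    have := deriv_sub_le c (hs (Ioo_subset_Icc_self hc)) a ha hc.2.le
    nlinarith

/-- Proposition 1': gradient bound for nonnegative `C²` functions on
`(-R, R)` with one-sided bound `u'' ≤ M`. -/
theorem simple_inequality_one_sided (R M : ℝ) (hR : 0 < R) (hM : 0 ≤ M)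
    (u : ℝ → ℝ) (hu : ContDiffOn ℝ 2 u (Ioo (-R) R))
    (hnonneg : ∀ x ∈ Ioo (-R) R, 0 ≤ u x)
    (hbound : ∀ x ∈ Ioo (-R) R, deriv (deriv u) x ≤ M) :
    (2 * u 0 / R ^ 2 ≤ M → |deriv u 0| ≤ Real.sqrt (2 * u 0 * M)) ∧
    (M < 2 * u 0 / R ^ 2 → |deriv u 0| ≤ u 0 / R + (R / 2) * M) := by
  have h0 : (0 : ℝ) ∈ Ioo (-R) R := ⟨by linarith, hR⟩
  have quad_nonneg_Ioo : ∀ x ∈ Ioo (-R) R, 0 ≤ u 0 + deriv u 0 * x + M / 2 * x ^ 2 :=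
    fun x hx => by
      simpa using (hnonneg x hx).trans
        ((convex_Ioo (-R) R).image_le_quadratic_of_deriv2_le isOpen_Ioo hu hbound h0 hx)
  have quad_nonneg : ∀ x ∈ Icc (-R) R, 0 ≤ u 0 + deriv u 0 * x + M / 2 * x ^ 2 := by
    rw [← closure_Ioo (by linarith : -R ≠ R)]
    have hclosed : IsClosed {x : ℝ | 0 ≤ u 0 + deriv u 0 * x + M / 2 * x ^ 2} :=
      isClosed_le (by fun_prop) (by fun_prop)
    exact closure_minimal quad_nonneg_Ioo hclosed
  have abs_mul_le : ∀ t, 0 ≤ t → t ≤ R → |deriv u 0| * t ≤ u 0 + M / 2 * t ^ 2 := by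
    intro t ht htR
    have h₁ := quad_nonneg t ⟨by linarith, htR⟩
    have h₂ := quad_nonneg (-t) ⟨by linarith, by linarith⟩
    rcases abs_cases (deriv u 0) with ⟨h, -⟩ | ⟨h, -⟩ <;> rw [h] <;> nlinarith
  have hend := abs_mul_le R hR.le le_rfl
  refine ⟨fun h => Real.le_sqrt_of_sq_le ?_, fun _ => ?_⟩
  · rw [div_le_iff₀ (by positivity)] at h
    have hle : |deriv u 0| ≤ M * R := le_of_mul_le_mul_right (by nlinarith) hR
    rcases hM.eq_or_lt with rfl | hM
    · have : |deriv u 0| = 0 := le_antisymm (by simpa using hle) (abs_nonneg _)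
      simp [this]
    · have hvertex := abs_mul_le (|deriv u 0| / M) (by positivity)
        ((div_le_iff₀ hM).2 (by linarith))
      field_simp at hvertex
      nlinarith
  · have : u 0 / R + R / 2 * M = (u 0 + M / 2 * R ^ 2) / R := by field_simp
    rwa [this, le_div_iff₀ hR]
end

section
/- There exists a constant C̄ depending only on n with the following property. Let R > 0, M > 0, and let u ≥ 0 be continuous on the parabolic cylinder B_R, of class C² in x and C¹ in t in the interior, satisfying |∂ₜu − Δu| ≤ M in B_R. Then: (i) if r := √(u(0,0)/M) ≤ R, then |∇ₓu(x,t)| + u(x,t)/r ≤ C̄·√(u(0,0)·M) for all (x,t) ∈ A_r; (ii) if R < √(u(0,0)/M), then |∇ₓu(x,t)| + u(x,t)/R ≤ C̄·(u(0,0)/R + M·R) for all (x,t) ∈ A_R. -/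
open Set

/-- Second partial derivative of `f` in the `i`-th coordinate direction. -/
noncomputable def secondPartial {n : ℕ} (f : EuclideanSpace ℝ (Fin n) → ℝ)
    (x : EuclideanSpace ℝ (Fin n)) (i : Fin n) : ℝ :=
  fderiv ℝ (fun y => fderiv ℝ f y (EuclideanSpace.single i 1)) x (EuclideanSpace.single i 1)

/-- Laplacian in the space variables of `u = u(x,t)`. -/
noncomputable def spatialLaplacian {n : ℕ} (u : EuclideanSpace ℝ (Fin n) → ℝ → ℝ)
    (x : EuclideanSpace ℝ (Fin n)) (t : ℝ) : ℝ :=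
  ∑ i, secondPartial (fun z => u z t) x i

open Filter Topology

/-- `c` is the second derivative of `g` at the origin. -/
def HasSecondDerivAtZero (g : ℝ → ℝ) (c : ℝ) : Prop :=
  ∃ g' : ℝ → ℝ, (∀ᶠ h in 𝓝 (0 : ℝ), HasDerivAt g (g' h) h) ∧ HasDerivAt g' c 0

namespace HasSecondDerivAtZero

variable {f g : ℝ → ℝ} {a b : ℝ}

theorem congr (hf : HasSecondDerivAtZero f a) (h : ∀ t, g t = f t) :
    HasSecondDerivAtZero g a :=
  (funext h : g = f) ▸ hf

theorem sub (hf : HasSecondDerivAtZero f a) (hg : HasSecondDerivAtZero g b) :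
    HasSecondDerivAtZero (fun h => f h - g h) (a - b) := by
  obtain ⟨f', hf, hf'⟩ := hf
  obtain ⟨g', hg, hg'⟩ := hg
  refine ⟨fun h => f' h - g' h, ?_, hf'.sub hg'⟩
  filter_upwards [hf, hg] with h h₁ h₂ using h₁.sub h₂

theorem const_mul (k : ℝ) (hf : HasSecondDerivAtZero f a) :
    HasSecondDerivAtZero (fun h => k * f h) (k * a) := by
  obtain ⟨f', hf, hf'⟩ := hf
  refine ⟨fun h => k * f' h, ?_, hf'.const_mul k⟩
  filter_upwards [hf] with h h₁ using h₁.const_mul k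

theorem comp_neg (hf : HasSecondDerivAtZero f a) :
    HasSecondDerivAtZero (fun h => f (-h)) a := by
  obtain ⟨f', hf, hf'⟩ := hf
  refine ⟨fun h => -f' (-h), ?_, ?_⟩
  · have ht : Tendsto (fun h : ℝ => -h) (𝓝 0) (𝓝 0) := by
      simpa using (continuous_neg (G := ℝ)).tendsto 0
    filter_upwards [ht.eventually hf] with h h₁
    have h₂ := HasDerivAt.comp h h₁ (hasDerivAt_neg h)
    rw [mul_neg_one] at h₂
    exact h₂
  · have h₁ : HasDerivAt f' a (-(0 : ℝ)) := by simpa using hf'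
    have h₂ := (HasDerivAt.comp (0 : ℝ) h₁ (hasDerivAt_neg (0 : ℝ))).neg
    rw [mul_neg_one, neg_neg] at h₂
    exact h₂

theorem nonpos_of_isLocalMax (hf : HasSecondDerivAtZero f a) (hmax : IsLocalMax f 0) :
    a ≤ 0 := by
  obtain ⟨f', hf, hf'⟩ := hf
  by_contra! ha
  have hd : deriv f =ᶠ[𝓝 0] f' := hf.mono fun h hh => hh.deriv
  have h2 : deriv (deriv f) 0 = a := by rw [hd.deriv_eq, hf'.deriv]
  have hmin : IsLocalMin f 0 :=
    isLocalMin_of_deriv_deriv_pos (by rwa [h2]) hmax.deriv_eq_zero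
      hf.self_of_nhds.continuousAt
  have hc : f =ᶠ[𝓝 0] fun _ => f 0 := by
    filter_upwards [hmax, hmin] with h h₁ h₂ using le_antisymm h₁ h₂
  have h3 : deriv (deriv f) 0 = 0 := by
    rw [hc.deriv.deriv_eq]; simp
  linarith

end HasSecondDerivAtZero

theorem HasDerivAt.nonneg_of_eventually_le_right {g : ℝ → ℝ} {a c : ℝ} (hg : HasDerivAt g c a)
    (h : ∀ᶠ t in 𝓝[>] a, g a ≤ g t) : 0 ≤ c := by
  have h1 := hg.tendsto_slope.mono_left (nhdsWithin_mono (s := Ioi a) a fun t ht => ne_of_gt ht)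
  refine ge_of_tendsto h1 ?_
  filter_upwards [h, self_mem_nhdsWithin] with t ht (hat : a < t)
  rw [slope_def_field]
  exact div_nonneg (by linarith) (by linarith)

theorem HasDerivAt.nonneg_of_eventually_le_left {g : ℝ → ℝ} {a c : ℝ} (hg : HasDerivAt g c a)
    (h : ∀ᶠ t in 𝓝[<] a, g t ≤ g a) : 0 ≤ c := by
  have h1 := hg.tendsto_slope.mono_left (nhdsWithin_mono (s := Iio a) a fun t ht => ne_of_lt ht)
  refine ge_of_tendsto h1 ?_
  filter_upwards [h, self_mem_nhdsWithin] with t ht (hat : t < a)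
  rw [slope_def_field]
  exact div_nonneg_of_nonpos (by linarith) (by linarith)

section Space

variable {n : ℕ}

theorem norm_add_smul_single_sq (z : EuclideanSpace ℝ (Fin n)) (h : ℝ) (i : Fin n) :
    ‖z + h • EuclideanSpace.single i (1 : ℝ)‖ ^ 2 = ‖z‖ ^ 2 + 2 * h * z i + h ^ 2 := by
  rw [norm_add_sq_real, inner_smul_right, norm_smul]
  simp [EuclideanSpace.inner_single_right]
  ring

theorem norm_le_sum_abs_apply_single (L : EuclideanSpace ℝ (Fin n) →L[ℝ] ℝ) :
    ‖L‖ ≤ ∑ i, |L (EuclideanSpace.single i 1)| := by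
  refine L.opNorm_le_bound (by positivity) fun v => ?_
  have hv : v = ∑ i, v i • EuclideanSpace.single i (1 : ℝ) := by
    ext j; simp [Finset.sum_apply, Pi.single_apply]
  conv_lhs => rw [hv]
  rw [map_sum, Finset.sum_mul]
  refine (norm_sum_le _ _).trans (Finset.sum_le_sum fun i _ => ?_)
  rw [map_smul, norm_smul, mul_comm, Real.norm_eq_abs (L _)]
  gcongr
  exact PiLp.norm_apply_le v i

theorem hasSecondDerivAtZero_line {f : EuclideanSpace ℝ (Fin n) → ℝ}
    {x : EuclideanSpace ℝ (Fin n)} (hf : ContDiffAt ℝ 2 f x) (i : Fin n) :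
    HasSecondDerivAtZero (fun h => f (x + h • EuclideanSpace.single i (1 : ℝ)))
      (secondPartial f x i) := by
  set e : EuclideanSpace ℝ (Fin n) := EuclideanSpace.single i (1 : ℝ) with he
  have hl : ∀ h : ℝ, HasDerivAt (fun h : ℝ => x + h • e) e h := fun h => by
    simpa using ((hasDerivAt_id h).smul_const e).const_add x
  refine ⟨fun h => fderiv ℝ f (x + h • e) e, ?_, ?_⟩
  · have ht : Tendsto (fun h : ℝ => x + h • e) (𝓝 0) (𝓝 x) := by
      simpa using (hl 0).continuousAt.tendsto
    have hd : ∀ᶠ y in 𝓝 x, DifferentiableAt ℝ f y :=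
      (hf.eventually (by simp)).mono fun y hy => hy.differentiableAt (by simp)
    filter_upwards [ht.eventually hd] with h hh
    exact hh.hasFDerivAt.comp_hasDerivAt h (hl h)
  · have h1 : ContDiffAt ℝ 1 (fderiv ℝ f) x := hf.fderiv_right (by norm_num)
    have h2 : DifferentiableAt ℝ (fun y => fderiv ℝ f y e) x :=
      (h1.differentiableAt (by simp)).clm_apply (differentiableAt_const e)
    have h3 : HasFDerivAt (fun y => fderiv ℝ f y e) (fderiv ℝ (fun y => fderiv ℝ f y e) x)
        (x + (0 : ℝ) • e) := by simpa using h2.hasFDerivAt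
    exact h3.comp_hasDerivAt (0 : ℝ) (hl 0)

/-- Weak parabolic maximum principle, for functions which are only separately differentiable. -/
theorem nonpos_of_parabolic_strict_subsolution {K : Set (EuclideanSpace ℝ (Fin n) × ℝ)}
    (hK : IsCompact K) {F : EuclideanSpace ℝ (Fin n) → ℝ → ℝ}
    (hF : ContinuousOn (fun p : EuclideanSpace ℝ (Fin n) × ℝ => F p.1 p.2) K)
    (h : ∀ x t, (x, t) ∈ K → F x t ≤ 0 ∨
      ((∀ᶠ y in 𝓝 x, (y, t) ∈ K) ∧ (∀ᶠ s in 𝓝[<] t, (x, s) ∈ K) ∧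
        ∃ (τ : ℝ) (c : Fin n → ℝ), HasDerivAt (fun s => F x s) τ t ∧
          (∀ i, HasSecondDerivAtZero
            (fun h => F (x + h • EuclideanSpace.single i (1 : ℝ)) t) (c i)) ∧
          τ < ∑ i, c i)) :
    ∀ x t, (x, t) ∈ K → F x t ≤ 0 := by
  intro x t hxt
  obtain ⟨⟨x₀, t₀⟩, hp, hmax⟩ := hK.exists_isMaxOn ⟨_, hxt⟩ hF
  have hmax' : ∀ y s, (y, s) ∈ K → F y s ≤ F x₀ t₀ := fun y s hys => hmax hys
  refine (hmax' x t hxt).trans ?_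
  obtain h0 | ⟨hx, ht, τ, c, hτ, hc, hlt⟩ := h x₀ t₀ hp
  · exact h0
  have h1 : 0 ≤ τ := hτ.nonneg_of_eventually_le_left (ht.mono fun s hs => hmax' _ _ hs)
  have h2 : ∑ i, c i ≤ 0 := Finset.sum_nonpos fun i _ => by
    refine (hc i).nonpos_of_isLocalMax ?_
    have hl : Tendsto (fun h : ℝ => x₀ + h • EuclideanSpace.single i (1 : ℝ)) (𝓝 0) (𝓝 x₀) := by
      have : Continuous (fun h : ℝ => x₀ + h • EuclideanSpace.single i (1 : ℝ)) := by fun_prop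
      simpa using this.tendsto 0
    filter_upwards [hl.eventually hx] with k hk
    simpa using hmax' _ _ hk
  linarith

end Space

/-- `u` is a nonnegative function on the parabolic cylinder of radius `R` which solves the heat
equation up to an error of size `M`. -/
structure IsApproxCaloric {n : ℕ} (R M : ℝ) (u : EuclideanSpace ℝ (Fin n) → ℝ → ℝ) : Prop where
  nonneg : ∀ x t, ‖x‖ < R → t ∈ Icc (-R ^ 2) (0 : ℝ) → 0 ≤ u x t
  continuousOn : ContinuousOn (fun p : EuclideanSpace ℝ (Fin n) × ℝ => u p.1 p.2)
    {p | ‖p.1‖ < R ∧ p.2 ∈ Icc (-R ^ 2) (0 : ℝ)}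
  contDiffOn_space : ∀ t ∈ Ioo (-R ^ 2) (0 : ℝ),
    ContDiffOn ℝ 2 (fun x => u x t) (Metric.ball 0 R)
  contDiffOn_time : ∀ x : EuclideanSpace ℝ (Fin n), ‖x‖ < R →
    ContDiffOn ℝ 1 (fun t => u x t) (Ioo (-R ^ 2) 0)
  abs_heat_le : ∀ x t, ‖x‖ < R → t ∈ Ioo (-R ^ 2) (0 : ℝ) →
    |deriv (fun s => u x s) t - spatialLaplacian u x t| ≤ M

namespace IsApproxCaloric

variable {n : ℕ} {R M : ℝ} {u : EuclideanSpace ℝ (Fin n) → ℝ → ℝ}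

theorem contDiffAt_space (hu : IsApproxCaloric R M u) {x : EuclideanSpace ℝ (Fin n)} {t : ℝ}
    (hx : ‖x‖ < R) (ht : t ∈ Ioo (-R ^ 2) (0 : ℝ)) : ContDiffAt ℝ 2 (fun z => u z t) x :=
  (hu.contDiffOn_space t ht).contDiffAt (Metric.isOpen_ball.mem_nhds (by simpa using hx))

theorem hasDerivAt_time (hu : IsApproxCaloric R M u) {x : EuclideanSpace ℝ (Fin n)} {t : ℝ}
    (hx : ‖x‖ < R) (ht : t ∈ Ioo (-R ^ 2) (0 : ℝ)) :
    HasDerivAt (fun s => u x s) (deriv (fun s => u x s) t) t :=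
  (((hu.contDiffOn_time x hx).contDiffAt (isOpen_Ioo.mem_nhds ht)).differentiableAt
    (by simp)).hasDerivAt

end IsApproxCaloric

section Reflection

variable {n : ℕ}

/-- Reflection in the hyperplane through `c` orthogonal to the `j`-th coordinate direction. -/
noncomputable def coordReflection (c : EuclideanSpace ℝ (Fin n)) (j : Fin n)
    (x : EuclideanSpace ℝ (Fin n)) : EuclideanSpace ℝ (Fin n) :=
  x + (-2 * (x j - c j)) • EuclideanSpace.single j (1 : ℝ)

theorem norm_coordReflection_sub (c : EuclideanSpace ℝ (Fin n)) (j : Fin n)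
    (x : EuclideanSpace ℝ (Fin n)) : ‖coordReflection c j x - c‖ = ‖x - c‖ := by
  have h := norm_add_smul_single_sq (x - c) (-2 * (x j - c j)) j
  have h' : ‖coordReflection c j x - c‖ ^ 2 = ‖x - c‖ ^ 2 := by
    rw [coordReflection, add_sub_right_comm, h, PiLp.sub_apply]; ring
  exact (pow_left_inj₀ (norm_nonneg _) (norm_nonneg _) two_ne_zero).1 h'

theorem coordReflection_of_eq {c : EuclideanSpace ℝ (Fin n)} {j : Fin n}
    {x : EuclideanSpace ℝ (Fin n)} (h : x j = c j) : coordReflection c j x = x := by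
  simp [coordReflection, h]

theorem coordReflection_add_smul (c : EuclideanSpace ℝ (Fin n)) (j : Fin n) (y : ℝ) :
    coordReflection c j (c + y • EuclideanSpace.single j (1 : ℝ)) =
      c + (-y) • EuclideanSpace.single j (1 : ℝ) := by
  rw [coordReflection, add_assoc, ← add_smul]
  congr 2
  simp
  ring

theorem continuous_coordReflection (c : EuclideanSpace ℝ (Fin n)) (j : Fin n) :
    Continuous (coordReflection c j) := by
  unfold coordReflection; fun_prop

theorem hasSecondDerivAtZero_line_coordReflection {f : EuclideanSpace ℝ (Fin n) → ℝ}
    {c x : EuclideanSpace ℝ (Fin n)} {j : Fin n} (hf : ContDiffAt ℝ 2 f (coordReflection c j x))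
    (i : Fin n) :
    HasSecondDerivAtZero
      (fun h => f (coordReflection c j (x + h • EuclideanSpace.single i (1 : ℝ))))
      (secondPartial f (coordReflection c j x) i) := by
  by_cases hij : i = j
  · subst hij
    refine (hasSecondDerivAtZero_line hf i).comp_neg.congr fun h => ?_
    congr 1
    simp only [coordReflection, add_assoc, ← add_smul]
    congr 2
    simp
    ring
  · refine (hasSecondDerivAtZero_line hf i).congr fun h => ?_
    have : (x + h • EuclideanSpace.single i (1 : ℝ)) j = x j := by
      simp [Ne.symm hij]
    rw [coordReflection, coordReflection, this]
    abel_nf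

end Reflection

namespace IsApproxCaloric

variable {n : ℕ} {R M : ℝ} {u : EuclideanSpace ℝ (Fin n) → ℝ → ℝ}

/-- Comparison of an odd reflection with a quadratic barrier. -/
theorem reflection_sub_le (hu : IsApproxCaloric R M u) (hM : 0 < M) {S d t₀ δ : ℝ}
    {x₀ : EuclideanSpace ℝ (Fin n)} (hd : 0 < d) (hx₀ : ‖x₀‖ + d < R)
    (ht₀ : -R ^ 2 < t₀ - d ^ 2) (ht₀' : t₀ < 0) (hδ : |δ| = 1)
    (hS : ∀ x t, ‖x - x₀‖ ≤ d → t ∈ Icc (t₀ - d ^ 2) t₀ → u x t ≤ S) (j : Fin n) {y : ℝ}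
    (hy : y ∈ Icc 0 d) :
    δ * (u (x₀ + y • EuclideanSpace.single j (1 : ℝ)) t₀ -
        u (x₀ + (-y) • EuclideanSpace.single j (1 : ℝ)) t₀) ≤
      S / d ^ 2 * y ^ 2 + (2 * M + (n + 1) * (S / d ^ 2)) * (y * (2 * d - y)) := by
  have hin : ∀ x : EuclideanSpace ℝ (Fin n), ‖x - x₀‖ ≤ d → ‖x‖ < R := fun x hx => by
    have := norm_le_norm_add_norm_sub' x x₀
    linarith
  have htin : ∀ t ∈ Icc (t₀ - d ^ 2) t₀, t ∈ Ioo (-R ^ 2) (0 : ℝ) := fun t ht =>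
    ⟨ht₀.trans_le ht.1, ht.2.trans_lt ht₀'⟩
  have hσn : ∀ x, ‖coordReflection x₀ j x - x₀‖ = ‖x - x₀‖ := norm_coordReflection_sub x₀ j
  have hS0 : 0 ≤ S := (hu.nonneg x₀ t₀ (hin x₀ (by simpa using hd.le))
    (Ioo_subset_Icc_self (htin t₀ ⟨by nlinarith, le_rfl⟩))).trans
    (hS x₀ t₀ (by simpa using hd.le) ⟨by nlinarith, le_rfl⟩)
  have hdiff : ∀ a b : ℝ, 0 ≤ a → a ≤ S → 0 ≤ b → b ≤ S → δ * (a - b) ≤ S := by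
    intro a b _ _ _ _
    calc δ * (a - b) ≤ |δ * (a - b)| := le_abs_self _
      _ = |a - b| := by rw [abs_mul, hδ, one_mul]
      _ ≤ S := abs_le.2 ⟨by linarith, by linarith⟩
  set k : ℝ := S / d ^ 2 with hk
  have hk0 : 0 ≤ k := by positivity
  have hkd : k * d ^ 2 = S := by rw [hk]; field_simp
  set B : ℝ := 2 * M + (n + 1) * k with hB
  have hB0 : 0 ≤ B := by positivity
  let K : Set (EuclideanSpace ℝ (Fin n) × ℝ) :=
    (Metric.closedBall x₀ d ∩ {x | x₀ j ≤ x j}) ×ˢ Icc (t₀ - d ^ 2) t₀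
  have hK : IsCompact K := by
    refine ((isCompact_closedBall x₀ d).inter_right ?_).prod isCompact_Icc
    exact isClosed_le (by fun_prop) (by fun_prop)
  have hKmem : ∀ x t, (x, t) ∈ K ↔
      (‖x - x₀‖ ≤ d ∧ x₀ j ≤ x j) ∧ t ∈ Icc (t₀ - d ^ 2) t₀ := fun x t => by
    simp [K, dist_eq_norm]
  let F : EuclideanSpace ℝ (Fin n) → ℝ → ℝ := fun x t =>
    δ * (u x t - u (coordReflection x₀ j x) t) -
      (k * (‖x - x₀‖ ^ 2 + (t₀ - t)) + B * ((x j - x₀ j) * (2 * d - (x j - x₀ j))))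
  have hyd : ∀ x : EuclideanSpace ℝ (Fin n), ‖x - x₀‖ ≤ d → x j - x₀ j ≤ d := fun x hx =>
    (le_abs_self _).trans ((PiLp.norm_apply_le (x - x₀) j).trans hx)
  have hF : ContinuousOn (fun p : EuclideanSpace ℝ (Fin n) × ℝ => F p.1 p.2) K := by
    have hsub : ∀ p ∈ K, p ∈ {p : EuclideanSpace ℝ (Fin n) × ℝ |
        ‖p.1‖ < R ∧ p.2 ∈ Icc (-R ^ 2) (0 : ℝ)} := fun p hp =>
      ⟨hin _ ((hKmem p.1 p.2).1 hp).1.1,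
        Ioo_subset_Icc_self (htin _ ((hKmem p.1 p.2).1 hp).2)⟩
    have hσK : ∀ p ∈ K, (coordReflection x₀ j p.1, p.2) ∈ {p : EuclideanSpace ℝ (Fin n) × ℝ |
        ‖p.1‖ < R ∧ p.2 ∈ Icc (-R ^ 2) (0 : ℝ)} := fun p hp =>
      ⟨hin _ (by rw [hσn]; exact ((hKmem p.1 p.2).1 hp).1.1),
        Ioo_subset_Icc_self (htin _ ((hKmem p.1 p.2).1 hp).2)⟩
    have h1 := hu.continuousOn.mono hsub
    have h2 : ContinuousOn (fun p : EuclideanSpace ℝ (Fin n) × ℝ =>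
        u (coordReflection x₀ j p.1) p.2) K :=
      hu.continuousOn.comp (f := fun p : EuclideanSpace ℝ (Fin n) × ℝ =>
        (coordReflection x₀ j p.1, p.2))
        (((continuous_coordReflection x₀ j).comp continuous_fst).prodMk
          continuous_snd).continuousOn hσK
    refine ((h1.sub h2).const_smul δ).sub (Continuous.continuousOn ?_)
    fun_prop
  have hmain := nonpos_of_parabolic_strict_subsolution hK hF (fun x t hxt => ?_)
    (x₀ + y • EuclideanSpace.single j (1 : ℝ)) t₀ ?_
  · simp only [F, coordReflection_add_smul, add_sub_cancel_left, norm_smul, sub_self] at hmain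
    simp at hmain
    rw [neg_smul]
    linarith
  · obtain ⟨⟨hx, hxj⟩, ht⟩ := (hKmem x t).1 hxt
    have hq : 0 ≤ B * ((x j - x₀ j) * (2 * d - (x j - x₀ j))) :=
      mul_nonneg hB0 (mul_nonneg (by linarith) (by linarith [hyd x hx]))
    have hσx : ‖coordReflection x₀ j x - x₀‖ ≤ d := by rw [hσn]; exact hx
    have htI := htin t ht
    have hdi := hdiff (u x t) (u (coordReflection x₀ j x) t)
      (hu.nonneg _ _ (hin x hx) (Ioo_subset_Icc_self htI)) (hS x t hx ht)
      (hu.nonneg _ _ (hin _ hσx) (Ioo_subset_Icc_self htI)) (hS _ t hσx ht)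
    by_cases hxd : ‖x - x₀‖ = d
    · left
      have : k * d ^ 2 ≤ k * (‖x - x₀‖ ^ 2 + (t₀ - t)) := by
        rw [hxd]; gcongr; linarith [ht.2]
      simp only [F]; linarith
    by_cases htd : t = t₀ - d ^ 2
    · left
      have : k * d ^ 2 ≤ k * (‖x - x₀‖ ^ 2 + (t₀ - t)) := by
        rw [htd]; gcongr; nlinarith [sq_nonneg ‖x - x₀‖]
      simp only [F]; linarith
    by_cases hxj0 : x j = x₀ j
    · left
      have : 0 ≤ k * (‖x - x₀‖ ^ 2 + (t₀ - t)) :=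
        mul_nonneg hk0 (by nlinarith [sq_nonneg ‖x - x₀‖, ht.2])
      simp only [F, coordReflection_of_eq hxj0, hxj0, sub_self]
      simpa using this
    right
    refine ⟨?_, ?_, δ * (deriv (fun s => u x s) t -
        deriv (fun s => u (coordReflection x₀ j x) s) t) - k * (-1),
      fun i => δ * (secondPartial (fun z => u z t) x i -
        secondPartial (fun z => u z t) (coordReflection x₀ j x) i) -
        (2 * k + if i = j then -2 * B else 0), ?_, fun i => ?_, ?_⟩
    · have h1 : ∀ᶠ z in 𝓝 x, ‖z - x₀‖ < d :=
        (isOpen_lt (f := fun z => ‖z - x₀‖) (g := fun _ => d)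
          (by fun_prop) (by fun_prop)).mem_nhds (lt_of_le_of_ne hx hxd)
      have h2 : ∀ᶠ z in 𝓝 x, x₀ j < z j :=
        (isOpen_lt (f := fun _ => x₀ j) (g := fun z : EuclideanSpace ℝ (Fin n) => z j)
          (by fun_prop) (by fun_prop)).mem_nhds (lt_of_le_of_ne hxj (Ne.symm hxj0))
      filter_upwards [h1, h2] with z h1 h2
      exact (hKmem z t).2 ⟨⟨h1.le, h2.le⟩, ht⟩
    · have h1 : ∀ᶠ s in 𝓝[<] t, t₀ - d ^ 2 < s :=
        mem_nhdsWithin_of_mem_nhds (Ioi_mem_nhds (lt_of_le_of_ne ht.1 (Ne.symm htd)))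
      filter_upwards [h1, self_mem_nhdsWithin] with s h1 h2
      exact (hKmem x s).2 ⟨⟨hx, hxj⟩, h1.le, (le_of_lt h2).trans ht.2⟩
    · refine (((hu.hasDerivAt_time (hin x hx) htI).sub
        (hu.hasDerivAt_time (hin _ hσx) htI)).const_mul δ).sub ?_
      exact ((((hasDerivAt_id t).const_sub t₀).const_add (‖x - x₀‖ ^ 2)).const_mul k).add_const _
    · refine (((hasSecondDerivAtZero_line (hu.contDiffAt_space (hin x hx) htI) i).sub
        (hasSecondDerivAtZero_line_coordReflection
          (hu.contDiffAt_space (hin _ hσx) htI) i)).const_mul δ).sub ?_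
      have hline : ∀ h : ℝ, ‖x + h • EuclideanSpace.single i (1 : ℝ) - x₀‖ ^ 2 =
          ‖x - x₀‖ ^ 2 + 2 * h * (x - x₀) i + h ^ 2 := fun h => by
        rw [add_sub_right_comm, norm_add_smul_single_sq]
      simp only [hline]
      by_cases hij : i = j
      · subst hij
        rw [if_pos rfl]
        set a := x i - x₀ i with ha
        have hco : ∀ h : ℝ, (x + h • EuclideanSpace.single i (1 : ℝ)) i - x₀ i = a + h :=
          fun h => by simp [ha]; ring
        simp only [hco]
        refine ⟨fun h => k * (2 * (x - x₀) i + 2 * h) + B * (2 * d - 2 * (a + h)),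
          Eventually.of_forall fun h => ?_, ?_⟩
        · have hid := hasDerivAt_id' h
          refine (((((hid.const_mul 2).mul_const ((x - x₀) i)).const_add (‖x - x₀‖ ^ 2)).add
            (hid.pow 2)).add_const (t₀ - t) |>.const_mul k).add
            (((hid.const_add a).mul ((hid.const_add a).const_sub (2 * d))).const_mul B)
            |>.congr_deriv ?_
          push_cast; ring
        · have hid := hasDerivAt_id' (0 : ℝ)
          refine (((hid.const_mul 2).const_add (2 * (x - x₀) i)).const_mul k).add
            ((((hid.const_add a).const_mul 2).const_sub (2 * d)).const_mul B)
            |>.congr_deriv ?_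
          ring
      · rw [if_neg hij]
        have hco : ∀ h : ℝ, (x + h • EuclideanSpace.single i (1 : ℝ)) j = x j :=
          fun h => by simp [Ne.symm hij]
        simp only [hco]
        refine ⟨fun h => k * (2 * (x - x₀) i + 2 * h),
          Eventually.of_forall fun h => ?_, ?_⟩
        · have hid := hasDerivAt_id' h
          refine (((((hid.const_mul 2).mul_const ((x - x₀) i)).const_add (‖x - x₀‖ ^ 2)).add
            (hid.pow 2)).add_const (t₀ - t) |>.const_mul k).add_const _
            |>.congr_deriv ?_
          simp
        · have hid := hasDerivAt_id' (0 : ℝ)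
          refine (((hid.const_mul 2).const_add (2 * (x - x₀) i)).const_mul k)
            |>.congr_deriv ?_
          ring
    · have e1 := hu.abs_heat_le x t (hin x hx) htI
      have e2 := hu.abs_heat_le _ t (hin _ hσx) htI
      simp only [spatialLaplacian] at e1 e2
      rw [Finset.sum_sub_distrib, ← Finset.mul_sum, Finset.sum_sub_distrib,
        Finset.sum_add_distrib, Finset.sum_ite_eq' Finset.univ j]
      simp only [Finset.sum_const, Finset.card_univ, Fintype.card_fin, nsmul_eq_mul,
        Finset.mem_univ, if_true]
      set D₁ := deriv (fun s => u x s) t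
      set D₂ := deriv (fun s => u (coordReflection x₀ j x) s) t
      set L₁ := ∑ i, secondPartial (fun z => u z t) x i
      set L₂ := ∑ i, secondPartial (fun z => u z t) (coordReflection x₀ j x) i
      have e3 : δ * ((D₁ - L₁) - (D₂ - L₂)) ≤ 2 * M := by
        calc δ * ((D₁ - L₁) - (D₂ - L₂)) ≤ |δ * ((D₁ - L₁) - (D₂ - L₂))| := le_abs_self _
          _ = |(D₁ - L₁) - (D₂ - L₂)| := by rw [abs_mul, hδ, one_mul]
          _ ≤ |D₁ - L₁| + |D₂ - L₂| := abs_sub _ _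
          _ ≤ 2 * M := by linarith
      nlinarith [hB, hk0, hM]
  · refine (hKmem _ _).2 ⟨⟨?_, ?_⟩, by nlinarith, le_rfl⟩
    · simpa [norm_smul, abs_of_nonneg hy.1] using hy.2
    · simpa using hy.1

theorem abs_fderiv_single_le (hu : IsApproxCaloric R M u) (hM : 0 < M) {S d t₀ : ℝ}
    {x₀ : EuclideanSpace ℝ (Fin n)} (hd : 0 < d) (hx₀ : ‖x₀‖ + d < R)
    (ht₀ : -R ^ 2 < t₀ - d ^ 2) (ht₀' : t₀ < 0)
    (hS : ∀ x t, ‖x - x₀‖ ≤ d → t ∈ Icc (t₀ - d ^ 2) t₀ → u x t ≤ S) (j : Fin n) :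
    |fderiv ℝ (fun z => u z t₀) x₀ (EuclideanSpace.single j 1)| ≤
      2 * M * d + (n + 1) * (S / d) := by
  set e : EuclideanSpace ℝ (Fin n) := EuclideanSpace.single j 1 with he
  have key : ∀ δ : ℝ, |δ| = 1 → δ * fderiv ℝ (fun z => u z t₀) x₀ e ≤
      2 * M * d + (n + 1) * (S / d) := by
    intro δ hδ
    set A := fderiv ℝ (fun z => u z t₀) x₀ with hA
    have hfd : HasFDerivAt (fun z => u z t₀) A x₀ :=
      ((hu.contDiffAt_space (by linarith) ⟨by nlinarith, ht₀'⟩).differentiableAt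
        (by simp)).hasFDerivAt
    have hl : ∀ a : ℝ, HasDerivAt (fun y : ℝ => u (x₀ + (a * y) • e) t₀) (A (a • e)) 0 := by
      intro a
      have h1 : HasDerivAt (fun y : ℝ => x₀ + (a * y) • e) (a • e) 0 := by
        simpa using (((hasDerivAt_id (0 : ℝ)).const_mul a).smul_const e).const_add x₀
      have h2 : HasFDerivAt (fun z => u z t₀) A (x₀ + (a * 0) • e) := by simpa using hfd
      exact h2.comp_hasDerivAt (0 : ℝ) h1
    have hid := hasDerivAt_id' (0 : ℝ)
    have hg := (((hid.pow 2).const_mul (S / d ^ 2)).add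
      ((hid.mul (hid.const_sub (2 * d))).const_mul (2 * M + (n + 1) * (S / d ^ 2)))).sub
      (((hl 1).sub (hl (-1))).const_mul δ)
    have h0 := hg.nonneg_of_eventually_le_right (by
      filter_upwards [Ioo_mem_nhdsGT hd] with y hy
      have := hu.reflection_sub_le hM hd hx₀ ht₀ ht₀' hδ hS j ⟨hy.1.le, hy.2.le⟩
      simp at this ⊢
      linarith)
    simp at h0
    have h3 : S / d ^ 2 * d = S / d := by field_simp
    have h4 : (2 * M + (n + 1) * (S / d ^ 2)) * (2 * d) =
      2 * (2 * M * d + (n + 1) * (S / d)) := by rw [← h3]; ring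
    linarith
  refine abs_le'.2 ⟨?_, ?_⟩
  · simpa using key 1 (by simp)
  · simpa using key (-1) (by simp)

theorem norm_fderiv_le (hu : IsApproxCaloric R M u) (hM : 0 < M) {S d t₀ : ℝ}
    {x₀ : EuclideanSpace ℝ (Fin n)} (hd : 0 < d) (hx₀ : ‖x₀‖ + d < R)
    (ht₀ : -R ^ 2 < t₀ - d ^ 2) (ht₀' : t₀ < 0)
    (hS : ∀ x t, ‖x - x₀‖ ≤ d → t ∈ Icc (t₀ - d ^ 2) t₀ → u x t ≤ S) :
    ‖fderiv ℝ (fun z => u z t₀) x₀‖ ≤ n * (2 * M * d + (n + 1) * (S / d)) := by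
  refine (norm_le_sum_abs_apply_single _).trans ?_
  refine (Finset.sum_le_sum fun j _ =>
    hu.abs_fderiv_single_le hM hd hx₀ ht₀ ht₀' hS j).trans ?_
  simp [mul_add]

end IsApproxCaloric

/-- The algebraic inequality which makes `ω ^ 2 / s ^ (q + 2)` a subsolution of the heat equation,
where `ω = s - |z| ^ 2`. -/
theorem moving_barrier_ineq {N ω s a : ℝ} {q : ℕ} (hω : 0 < ω) (hs : 0 < s)
    (ha : a ≤ 3) (hq : 25 * (21 + 4 * N) ^ 2 ≤ 2 * ((q : ℝ) + 2)) :
    (2 * ω * (1 / 400 + 2 * a) * s ^ (q + 2) - ω ^ 2 * (((q : ℝ) + 2) * s ^ (q + 1) * (1 / 400))) /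
      (s ^ (q + 2)) ^ 2 ≤ (8 * (s - ω) - 4 * N * ω) / s ^ (q + 2) := by
  have h1 : ω * s * (2 / 400 + 4 * a + 4 * N + 8) ≤ ω * s * (21 + 4 * N) :=
    mul_le_mul_of_nonneg_left (by linarith) (by positivity)
  have h2 : (21 + 4 * N) ^ 2 * ω ^ 2 / 32 ≤ ω ^ 2 * (((q : ℝ) + 2) / 400) := by
    have : 25 * (21 + 4 * N) ^ 2 * ω ^ 2 ≤ 2 * ((q : ℝ) + 2) * ω ^ 2 := by gcongr
    linarith
  have h3 := sq_nonneg ((21 + 4 * N) * ω - 16 * s)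
  have h4 : 2 * ω * (1 / 400 + 2 * a) * s - ω ^ 2 * (((q : ℝ) + 2) * (1 / 400)) ≤
      (8 * (s - ω) - 4 * N * ω) * s := by nlinarith
  rw [div_le_div_iff₀ (by positivity) (by positivity)]
  calc _ = (2 * ω * (1 / 400 + 2 * a) * s - ω ^ 2 * (((q : ℝ) + 2) * (1 / 400))) *
        (s ^ (q + 1) * s ^ (q + 2)) := by ring
    _ ≤ ((8 * (s - ω) - 4 * N * ω) * s) * (s ^ (q + 1) * s ^ (q + 2)) := by gcongr
    _ = _ := by ring

namespace IsApproxCaloric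

variable {n : ℕ} {R M : ℝ} {u : EuclideanSpace ℝ (Fin n) → ℝ → ℝ}

/-- Comparison with a subsolution supported in a paraboloid whose axis joins `(x₁, t₁)` to the
origin. -/
theorem moving_barrier_le (hu : IsApproxCaloric R M u) (hM : 0 < M) {r ρ L t₁ T : ℝ} {q : ℕ}
    {x₁ : EuclideanSpace ℝ (Fin n)} (hr : 0 < r) (hrR : r ≤ R) (hρ : 0 < ρ) (hL : 0 ≤ L)
    (hx₁ : ‖x₁‖ + ρ + r / 20 < r) (ht₁ : -r ^ 2 < t₁) (ht₁' : t₁ ≤ -(1 / 3) * r ^ 2)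
    (hT : T ∈ Ioo t₁ 0) (hq : 25 * (21 + 4 * (n : ℝ)) ^ 2 ≤ 2 * ((q : ℝ) + 2))
    (hLu : ∀ x, ‖x - x₁‖ ≤ ρ → L ≤ u x t₁) (x : EuclideanSpace ℝ (Fin n))
    (hx : ‖x - (T / t₁) • x₁‖ ^ 2 ≤ ρ ^ 2 + (T - t₁) / 400) :
    L * (ρ ^ 2) ^ q * ((ρ ^ 2 + (T - t₁) / 400 - ‖x - (T / t₁) • x₁‖ ^ 2) ^ 2 /
      (ρ ^ 2 + (T - t₁) / 400) ^ (q + 2)) - 2 * M * (T - t₁) ≤ u x T := by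
  have ht₁0 : t₁ < 0 := by nlinarith
  let s : ℝ → ℝ := fun t => ρ ^ 2 + (t - t₁) / 400
  let ω : EuclideanSpace ℝ (Fin n) → ℝ → ℝ := fun x t => s t - ‖x - (t / t₁) • x₁‖ ^ 2
  set c : ℝ := L * (ρ ^ 2) ^ q with hc
  have hc0 : 0 ≤ c := by positivity
  let F : EuclideanSpace ℝ (Fin n) → ℝ → ℝ := fun x t =>
    c * (ω x t ^ 2 / s t ^ (q + 2)) - 2 * M * (t - t₁) - u x t
  let K : Set (EuclideanSpace ℝ (Fin n) × ℝ) := {p | p.2 ∈ Icc t₁ T ∧ 0 ≤ ω p.1 p.2}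
  have hs0 : ∀ t, t₁ ≤ t → 0 < s t := fun t ht =>
    add_pos_of_pos_of_nonneg (by positivity) (by linarith)
  have hscont : Continuous s := by fun_prop
  have hωcont : Continuous fun p : EuclideanSpace ℝ (Fin n) × ℝ => ω p.1 p.2 := by fun_prop
  have hz : ∀ x t, (x, t) ∈ K → ‖x - (t / t₁) • x₁‖ ≤ ρ + r / 20 := by
    rintro x t ⟨ht, hω⟩
    refine abs_le_of_sq_le_sq' ?_ (by positivity) |>.2
    have h1 : ‖x - (t / t₁) • x₁‖ ^ 2 ≤ s t := sub_nonneg.1 hω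
    have h2 : t ≤ 0 := ht.2.trans hT.2.le
    have h3 : s t = ρ ^ 2 + (t - t₁) / 400 := rfl
    nlinarith [mul_pos hρ hr]
  have hin : ∀ x t, (x, t) ∈ K → ‖x‖ < R ∧ t ∈ Ico t₁ 0 := by
    rintro x t hxt
    obtain ⟨ht, hω⟩ := hxt
    have h2 : t < 0 := ht.2.trans_lt hT.2
    refine ⟨?_, ht.1, h2⟩
    have h4 : ‖(t / t₁) • x₁‖ ≤ ‖x₁‖ := by
      rw [norm_smul, Real.norm_eq_abs, abs_of_nonneg (div_nonneg_of_nonpos h2.le ht₁0.le)]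
      refine mul_le_of_le_one_left (norm_nonneg _) ?_
      rw [div_le_one_of_neg ht₁0]
      exact ht.1
    have h5 := norm_le_norm_add_norm_sub' x ((t / t₁) • x₁)
    have h6 := hz x t ⟨ht, hω⟩
    linarith
  have hrR2 : r ^ 2 ≤ R ^ 2 := by gcongr
  have hIcc : ∀ t, t ∈ Ico t₁ 0 → t ∈ Ioo (-R ^ 2) (0 : ℝ) := fun t ht =>
    ⟨by linarith [ht.1], ht.2⟩
  have hK : IsCompact K := by
    refine IsCompact.of_isClosed_subset
      ((isCompact_closedBall (0 : EuclideanSpace ℝ (Fin n)) R).prod (isCompact_Icc (a := t₁)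
        (b := T))) ?_ ?_
    · exact (isClosed_Icc.preimage continuous_snd).inter (isClosed_le continuous_const hωcont)
    · intro p hp
      exact ⟨by simpa using (hin p.1 p.2 hp).1.le, hp.1⟩
  have hF : ContinuousOn (fun p : EuclideanSpace ℝ (Fin n) × ℝ => F p.1 p.2) K := by
    have h1 : ContinuousOn (fun p : EuclideanSpace ℝ (Fin n) × ℝ =>
        ω p.1 p.2 ^ 2 / s p.2 ^ (q + 2)) K :=
      (hωcont.pow 2).continuousOn.div ((hscont.comp continuous_snd).pow (q + 2)).continuousOn
        fun p hp => (pow_pos (hs0 _ hp.1.1) _).ne'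
    refine ((h1.const_smul c).sub (Continuous.continuousOn ?_)).sub
      (hu.continuousOn.mono fun p hp => ?_)
    · fun_prop
    · exact ⟨(hin p.1 p.2 hp).1, Ioo_subset_Icc_self (hIcc _ (hin p.1 p.2 hp).2)⟩
  suffices h : F x T ≤ 0 from sub_nonpos.1 h
  refine nonpos_of_parabolic_strict_subsolution hK hF (fun x t hxt => ?_) x T
    ⟨⟨hT.1.le, le_rfl⟩, sub_nonneg.2 hx⟩
  obtain ⟨hxR, htI⟩ := hin x t hxt
  have htR := hIcc t htI
  have hst := hs0 t htI.1
  have hux := hu.nonneg x t hxR (Ioo_subset_Icc_self htR)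
  have hzx := hz x t hxt
  obtain ⟨ht, hω⟩ := hxt
  change 0 ≤ ω x t at hω
  change t ∈ Icc t₁ T at ht
  by_cases hω0 : ω x t = 0
  · left
    have : 0 ≤ 2 * M * (t - t₁) := mul_nonneg (by positivity) (by linarith [ht.1])
    simp only [F, hω0]
    simp
    linarith
  by_cases htt : t = t₁
  · left
    subst htt
    have h1 : s t = ρ ^ 2 := by simp [s]
    have h2 : ω x t = ρ ^ 2 - ‖x - x₁‖ ^ 2 := by simp only [ω, h1, div_self ht₁0.ne, one_smul]
    have h3 : ‖x - x₁‖ ≤ ρ := by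
      refine abs_le_of_sq_le_sq' ?_ hρ.le |>.2
      linarith
    have h4 : ω x t ≤ ρ ^ 2 := by rw [h2]; linarith [sq_nonneg ‖x - x₁‖]
    have h5 : c * (ω x t ^ 2 / s t ^ (q + 2)) ≤ L := by
      rw [h1, hc, ← mul_div_assoc, div_le_iff₀ (by positivity)]
      calc L * (ρ ^ 2) ^ q * ω x t ^ 2 ≤ L * (ρ ^ 2) ^ q * (ρ ^ 2) ^ 2 := by gcongr
        _ = L * (ρ ^ 2) ^ (q + 2) := by ring
    have := hLu x h3
    simp only [F, sub_self, mul_zero]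
    linarith
  right
  have hωp : 0 < ω x t := lt_of_le_of_ne hω (Ne.symm hω0)
  set z := x - (t / t₁) • x₁ with hzdef
  set a := inner ℝ z ((1 / t₁) • x₁) with ha
  have hωz : ω x t = s t - ‖z‖ ^ 2 := rfl
  have ha3 : a ≤ 3 := by
    refine (real_inner_le_norm _ _).trans ?_
    rw [norm_smul, Real.norm_eq_abs, abs_of_neg (one_div_neg.2 ht₁0)]
    have h1 : -(1 / t₁) ≤ 3 / r ^ 2 := by
      rw [← one_div_neg_eq_neg_one_div, div_le_div_iff₀ (by linarith) (by positivity)]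
      linarith
    calc ‖z‖ * (-(1 / t₁) * ‖x₁‖) ≤ r * (3 / r ^ 2 * r) := by
          gcongr
          · exact mul_nonneg (by simpa using ht₁0.le) (norm_nonneg _)
          · linarith [norm_nonneg x₁]
          · linarith
      _ = 3 := by field_simp
  refine ⟨?_, ?_, c * ((2 * ω x t * (1 / 400 + 2 * a) * s t ^ (q + 2) -
      ω x t ^ 2 * (((q : ℝ) + 2) * s t ^ (q + 1) * (1 / 400))) / (s t ^ (q + 2)) ^ 2) - 2 * M * 1 -
      deriv (fun s => u x s) t,
    fun i => c / s t ^ (q + 2) * (8 * z i ^ 2 - 4 * ω x t) -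
      secondPartial (fun z => u z t) x i, ?_, fun i => ?_, ?_⟩
  · have h1 : Continuous fun y => ω y t := by fun_prop
    filter_upwards [(isOpen_lt continuous_const h1).mem_nhds hωp] with y hy
    exact ⟨ht, le_of_lt hy⟩
  · have h1 : Continuous fun τ => ω x τ := by fun_prop
    filter_upwards [mem_nhdsWithin_of_mem_nhds ((isOpen_lt continuous_const h1).mem_nhds hωp),
      mem_nhdsWithin_of_mem_nhds (Ioi_mem_nhds (lt_of_le_of_ne ht.1 (Ne.symm htt))),
      self_mem_nhdsWithin] with τ h1 h2 h3
    exact ⟨⟨le_of_lt h2, (le_of_lt h3).trans ht.2⟩, le_of_lt h1⟩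
  · have hid := hasDerivAt_id' t
    have hds : HasDerivAt s (1 / 400) t := ((hid.sub_const t₁).div_const 400).const_add _
    have hdz : HasDerivAt (fun t => x - (t / t₁) • x₁) (-((1 / t₁) • x₁)) t :=
      ((hid.div_const t₁).smul_const x₁).const_sub x
    have hdω : HasDerivAt (fun t => ω x t) (1 / 400 + 2 * a) t :=
      (hds.sub hdz.norm_sq).congr_deriv (by rw [inner_neg_right]; ring)
    refine (((((hdω.pow 2).div (hds.pow (q + 2)) (pow_pos hst _).ne').const_mul c).sub
      ((hid.sub_const t₁).const_mul (2 * M))).sub (hu.hasDerivAt_time hxR htR)).congr_deriv ?_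
    simp
  · refine HasSecondDerivAtZero.sub ?_ (hasSecondDerivAtZero_line
      (hu.contDiffAt_space hxR htR) i)
    have hline : ∀ h : ℝ, ω (x + h • EuclideanSpace.single i (1 : ℝ)) t =
        ω x t - 2 * h * z i - h ^ 2 := fun h => by
      simp only [ω]
      rw [add_sub_right_comm x, norm_add_smul_single_sq]
      ring
    simp only [hline]
    refine ⟨fun h => c * (2 * (ω x t - 2 * h * z i - h ^ 2) * (-2 * z i - 2 * h) /
      s t ^ (q + 2)), Eventually.of_forall fun h => ?_, ?_⟩
    · have hid := hasDerivAt_id' h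
      refine ((((((hid.const_mul 2).mul_const (z i)).const_sub (ω x t)).sub (hid.pow 2)).pow 2
        |>.div_const (s t ^ (q + 2)) |>.const_mul c).sub_const (2 * M * (t - t₁))).congr_deriv ?_
      simp
    · have hid := hasDerivAt_id' (0 : ℝ)
      refine ((((((hid.const_mul 2).mul_const (z i)).const_sub (ω x t)).sub
        (hid.pow 2)).const_mul 2).mul ((hid.const_mul 2).const_sub (-2 * z i))
        |>.div_const (s t ^ (q + 2)) |>.const_mul c).congr_deriv ?_
      simp
      ring
  · have e1 := (abs_le.1 (hu.abs_heat_le x t hxR htR)).1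
    simp only [spatialLaplacian] at e1
    have e2 := moving_barrier_ineq hωp hst ha3 hq
    have e3 : ∑ i, z i ^ 2 = s t - ω x t := by
      rw [hωz, EuclideanSpace.norm_sq_eq]; simp
    rw [Finset.sum_sub_distrib, ← Finset.mul_sum, Finset.sum_sub_distrib, ← Finset.mul_sum, e3]
    simp only [Finset.sum_const, Finset.card_univ, Fintype.card_fin, nsmul_eq_mul]
    have e4 : c / s t ^ (q + 2) * (8 * (s t - ω x t) - n * (4 * ω x t)) =
        c * ((8 * (s t - ω x t) - 4 * n * ω x t) / s t ^ (q + 2)) := by ring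
    rw [e4]
    have e5 := mul_le_mul_of_nonneg_left e2 hc0
    linarith

theorem le_apply_zero_of_le_on_ball (hu : IsApproxCaloric R M u) (hM : 0 < M) {r ρ L t₁ : ℝ}
    {q : ℕ} {x₁ : EuclideanSpace ℝ (Fin n)} (hr : 0 < r) (hrR : r ≤ R) (hρ : 0 < ρ) (hL : 0 ≤ L)
    (hx₁ : ‖x₁‖ + ρ + r / 20 < r) (ht₁ : -r ^ 2 < t₁) (ht₁' : t₁ ≤ -(1 / 3) * r ^ 2)
    (hq : 25 * (21 + 4 * (n : ℝ)) ^ 2 ≤ 2 * ((q : ℝ) + 2))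
    (hLu : ∀ x, ‖x - x₁‖ ≤ ρ → L ≤ u x t₁) :
    L * (ρ ^ 2) ^ q ≤ (r ^ 2) ^ q * (u 0 0 + 2 * M * r ^ 2) := by
  have ht₁0 : t₁ < 0 := by nlinarith
  let s : ℝ → ℝ := fun t => ρ ^ 2 + (t - t₁) / 400
  let d : ℝ → ℝ := fun t => ‖(0 : EuclideanSpace ℝ (Fin n)) - (t / t₁) • x₁‖ ^ 2
  have hs0 : 0 < s 0 := add_pos_of_pos_of_nonneg (by positivity) (by linarith)
  have hd0 : d 0 = 0 := by simp [d]
  have hsr : s 0 ≤ r ^ 2 := by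
    have h1 : s 0 = ρ ^ 2 + (0 - t₁) / 400 := rfl
    have h2 : ρ ≤ r - r / 20 := by linarith [norm_nonneg x₁]
    have h3 : ρ ^ 2 ≤ (r - r / 20) ^ 2 := by gcongr
    nlinarith
  have hsc : Continuous s := by fun_prop
  have hdc : Continuous d := by fun_prop
  have hev : ∀ᶠ T in 𝓝[<] (0 : ℝ),
      L * (ρ ^ 2) ^ q * ((s T - d T) ^ 2 / s T ^ (q + 2)) - 2 * M * (T - t₁) ≤ u 0 T := by
    have h1 : ∀ᶠ T in 𝓝[<] (0 : ℝ), d T < s T :=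
      mem_nhdsWithin_of_mem_nhds ((isOpen_lt hdc hsc).mem_nhds (by rw [mem_ofPred, hd0]; exact hs0))
    filter_upwards [h1, Ioo_mem_nhdsLT ht₁0] with T h1 hT
    exact hu.moving_barrier_le hM hr hrR hρ hL hx₁ ht₁ ht₁' hT hq hLu 0 h1.le
  have hlim1 : Tendsto (fun T => L * (ρ ^ 2) ^ q * ((s T - d T) ^ 2 / s T ^ (q + 2)) -
      2 * M * (T - t₁)) (𝓝[<] (0 : ℝ)) (𝓝 (L * (ρ ^ 2) ^ q * ((s 0 - d 0) ^ 2 / s 0 ^ (q + 2)) -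
      2 * M * (0 - t₁))) := by
    refine tendsto_nhdsWithin_of_tendsto_nhds (ContinuousAt.tendsto ?_)
    refine ContinuousAt.sub (continuousAt_const.mul (ContinuousAt.div ?_ ?_
      (pow_pos hs0 _).ne')) ?_
    · exact ((hsc.sub hdc).pow 2).continuousAt
    · exact (hsc.pow _).continuousAt
    · fun_prop
  have hlim2 : Tendsto (fun T => u 0 T) (𝓝[<] (0 : ℝ)) (𝓝 (u 0 0)) := by
    have hR : 0 < R := hr.trans_le hrR
    have h1 := hu.continuousOn (0, 0) ⟨by simpa using hR, by simp; positivity⟩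
    refine Tendsto.comp (g := fun p : EuclideanSpace ℝ (Fin n) × ℝ => u p.1 p.2)
      (f := fun T : ℝ => ((0 : EuclideanSpace ℝ (Fin n)), T)) h1 ?_
    refine tendsto_nhdsWithin_iff.2 ⟨?_, ?_⟩
    · refine tendsto_nhdsWithin_of_tendsto_nhds (Continuous.tendsto ?_ 0)
      fun_prop
    · have : -R ^ 2 < 0 := by nlinarith
      filter_upwards [Ioo_mem_nhdsLT this] with T hT
      exact ⟨by simpa using hR, hT.1.le, hT.2.le⟩
  have hle := le_of_tendsto_of_tendsto hlim1 hlim2 hev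
  rw [hd0, sub_zero] at hle
  have h2 : s 0 ^ 2 / s 0 ^ (q + 2) = 1 / s 0 ^ q := by
    rw [pow_add]; field_simp
  rw [h2, mul_one_div] at hle
  have h3 : L * (ρ ^ 2) ^ q / s 0 ^ q ≤ u 0 0 + 2 * M * r ^ 2 := by
    have : M * -t₁ ≤ M * r ^ 2 := by gcongr; linarith
    linarith
  have h4 : 0 ≤ u 0 0 + 2 * M * r ^ 2 := le_trans (by positivity) h3
  rw [div_le_iff₀ (by positivity)] at h3
  calc L * (ρ ^ 2) ^ q ≤ (u 0 0 + 2 * M * r ^ 2) * s 0 ^ q := h3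
    _ ≤ (u 0 0 + 2 * M * r ^ 2) * (r ^ 2) ^ q := by gcongr
    _ = _ := mul_comm _ _

end IsApproxCaloric

/-- Squared parabolic distance to the parabolic boundary of the cylinder of radius `ρ`, up to a
constant factor. -/
noncomputable def cylinderWeight {n : ℕ} (ρ : ℝ) (x : EuclideanSpace ℝ (Fin n)) (t : ℝ) : ℝ :=
  min ((ρ - ‖x‖) ^ 2) (t + ρ ^ 2)

namespace IsApproxCaloric

variable {n : ℕ} {R M : ℝ} {u : EuclideanSpace ℝ (Fin n) → ℝ → ℝ}

/-- If the values of `u` near `(x₁, t₁)` are controlled by `u x₁ t₁`, then `u` is bounded below on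
a ball around `x₁` of comparable radius. -/
theorem half_le_of_le_mul (hu : IsApproxCaloric R M u) (hM : 0 < M) {A δ t₁ G θ : ℝ}
    {x₁ : EuclideanSpace ℝ (Fin n)} (hδ : 0 < δ) (hx₁ : ‖x₁‖ + δ / 2 < R)
    (ht₁ : -R ^ 2 < t₁ - (δ / 4) ^ 2) (ht₁' : t₁ < 0)
    (hG : G = n * (1 / 2 + 4 * (n + 1) * A)) (hθ : 0 < θ) (hθ4 : θ ≤ 1 / 4) (hGθ : G * θ ≤ 1 / 2)
    (hL : M * δ ^ 2 ≤ u x₁ t₁)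
    (hA : ∀ x t, ‖x - x₁‖ ≤ δ / 2 → t ∈ Icc (t₁ - (δ / 4) ^ 2) t₁ → u x t ≤ A * u x₁ t₁)
    {x : EuclideanSpace ℝ (Fin n)} (hx : ‖x - x₁‖ ≤ θ * δ) : u x₁ t₁ / 2 ≤ u x t₁ := by
  set L := u x₁ t₁ with hLdef
  have hL0 : 0 ≤ L := le_trans (by positivity) hL
  have hball : ∀ y ∈ Metric.closedBall x₁ (θ * δ), ‖y - x₁‖ ≤ δ / 4 := fun y hy => by
    rw [mem_closedBall_iff_norm] at hy
    nlinarith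
  have hgrad : ∀ y ∈ Metric.closedBall x₁ (θ * δ),
      ‖fderiv ℝ (fun z => u z t₁) y‖ ≤ G * L / δ := fun y hy => by
    have hy4 := hball y hy
    have hyn := norm_le_norm_add_norm_sub' y x₁
    refine (hu.norm_fderiv_le hM (d := δ / 4) (S := A * L) (by positivity) (by linarith) ht₁ ht₁'
      fun w t hw ht => hA w t ?_ ht).trans ?_
    · have := norm_sub_le_norm_sub_add_norm_sub w y x₁
      linarith
    · have h1 : M * δ ≤ L / δ := by
        rw [le_div_iff₀ hδ]; linarith
      calc (n : ℝ) * (2 * M * (δ / 4) + (n + 1) * (A * L / (δ / 4)))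
          = n * (1 / 2 * (M * δ) + 4 * (n + 1) * A * (L / δ)) := by ring
        _ ≤ n * (1 / 2 * (L / δ) + 4 * (n + 1) * A * (L / δ)) := by gcongr
        _ = G * L / δ := by rw [hG]; ring
  have hdiff : ∀ y ∈ Metric.closedBall x₁ (θ * δ), DifferentiableAt ℝ (fun z => u z t₁) y :=
    fun y hy => by
      have hy4 := hball y hy
      have hyn := norm_le_norm_add_norm_sub' y x₁
      exact (hu.contDiffAt_space (by linarith) ⟨by nlinarith, ht₁'⟩).differentiableAt (by simp)
  have hmv := (convex_closedBall x₁ (θ * δ)).norm_image_sub_le_of_norm_fderiv_le hdiff hgrad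
    (Metric.mem_closedBall_self (by positivity)) (mem_closedBall_iff_norm.2 hx)
  have h1 : G * L / δ * ‖x - x₁‖ ≤ L / 2 := by
    have hG0 : 0 ≤ G * L / δ := (norm_nonneg _).trans
      (hgrad x₁ (Metric.mem_closedBall_self (by positivity)))
    calc G * L / δ * ‖x - x₁‖ ≤ G * L / δ * (θ * δ) := by gcongr
      _ = G * θ * L := by field_simp
      _ ≤ 1 / 2 * L := by gcongr
      _ = L / 2 := by ring
  have h2 := (abs_le.1 (hmv.trans h1)).1
  linarith

theorem exists_weighted_harnack (n q : ℕ)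
    (hq : 25 * (21 + 4 * (n : ℝ)) ^ 2 ≤ 2 * ((q : ℝ) + 2)) :
    ∃ C : ℝ, 0 < C ∧ ∀ (R M r : ℝ) (u : EuclideanSpace ℝ (Fin n) → ℝ → ℝ),
      IsApproxCaloric R M u → 0 < M → 0 < r → r ≤ R →
      ∀ x t, ‖x‖ ≤ 9 / 10 * r → t ∈ Icc (-(9 / 10 * r) ^ 2) (-(1 / 3) * r ^ 2) →
        u x t * cylinderWeight (9 / 10 * r) x t ^ q ≤
          C * ((r ^ 2) ^ q * (u 0 0 + 2 * M * r ^ 2)) := by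
  set G : ℝ := n * (1 / 2 + 4 * (n + 1) * 4 ^ q) with hG
  have hG0 : 0 ≤ G := by positivity
  set θ : ℝ := 1 / (4 * (G + 1)) with hθ
  have hθ0 : 0 < θ := by positivity
  have hθ4 : θ ≤ 1 / 4 := by
    rw [hθ, div_le_div_iff₀ (by positivity) (by norm_num)]; linarith
  have hGθ : G * θ ≤ 1 / 2 := by
    rw [hθ, mul_one_div, div_le_div_iff₀ (by positivity) (by norm_num)]; linarith
  refine ⟨2 / (θ ^ 2) ^ q + 1, by positivity, ?_⟩
  intro R M r u hu hM hr hrR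
  set b : ℝ := 9 / 10 * r with hb
  have hb0 : 0 < b := by positivity
  have hR : 0 < R := hr.trans_le hrR
  have hr2 : 0 < r ^ 2 := by positivity
  have hrR2 : r ^ 2 ≤ R ^ 2 := by gcongr
  have hb2 : b ^ 2 = 81 / 100 * r ^ 2 := by rw [hb]; ring
  have hu00 : 0 ≤ u 0 0 := hu.nonneg 0 0 (by simpa using hR) ⟨by nlinarith, le_rfl⟩
  set E : ℝ := u 0 0 + 2 * M * r ^ 2 with hE
  have hE0 : 0 < E := by positivity
  have hME : M * r ^ 2 ≤ E := by nlinarith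
  let K : Set (EuclideanSpace ℝ (Fin n) × ℝ) :=
    Metric.closedBall 0 b ×ˢ Icc (-b ^ 2) (-(1 / 3) * r ^ 2)
  have hKmem : ∀ x t, (x, t) ∈ K ↔ ‖x‖ ≤ b ∧ t ∈ Icc (-b ^ 2) (-(1 / 3) * r ^ 2) := fun x t => by
    simp [K]
  have hK : IsCompact K := (isCompact_closedBall _ _).prod isCompact_Icc
  have hKR : ∀ x t, (x, t) ∈ K → ‖x‖ < R ∧ t ∈ Ioo (-R ^ 2) (0 : ℝ) := fun x t hxt => by
    obtain ⟨h1, h2, h3⟩ := (hKmem x t).1 hxt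
    exact ⟨by linarith, by linarith, by linarith⟩
  have hcont : ContinuousOn (fun p : EuclideanSpace ℝ (Fin n) × ℝ =>
      u p.1 p.2 * cylinderWeight b p.1 p.2 ^ q) K := by
    refine (hu.continuousOn.mono fun p hp => ?_).mul (Continuous.continuousOn ?_)
    · exact ⟨(hKR p.1 p.2 hp).1, Ioo_subset_Icc_self (hKR p.1 p.2 hp).2⟩
    · unfold cylinderWeight; fun_prop
  intro x t hx ht
  obtain ⟨⟨x₁, t₁⟩, hp, hmax⟩ := hK.exists_isMaxOn ⟨_, (hKmem x t).2 ⟨hx, ht⟩⟩ hcont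
  have hmax' : ∀ y s, (y, s) ∈ K → u y s * cylinderWeight b y s ^ q ≤
    u x₁ t₁ * cylinderWeight b x₁ t₁ ^ q := fun y s hys => hmax hys
  refine (hmax' x t ((hKmem x t).2 ⟨hx, ht⟩)).trans ?_
  obtain ⟨hx₁, ht₁, ht₁'⟩ := (hKmem x₁ t₁).1 hp
  obtain ⟨hx₁R, ht₁R⟩ := hKR x₁ t₁ hp
  set Φ := cylinderWeight b x₁ t₁ with hΦ
  set L := u x₁ t₁ with hL
  have hL0 : 0 ≤ L := hu.nonneg _ _ hx₁R (Ioo_subset_Icc_self ht₁R)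
  have hΦ0 : 0 ≤ Φ := le_min (sq_nonneg _) (by linarith)
  have hΦt : Φ ≤ t₁ + b ^ 2 := min_le_right _ _
  have hΦx : Φ ≤ (b - ‖x₁‖) ^ 2 := min_le_left _ _
  have hΦr : Φ ≤ r ^ 2 := by linarith
  have hCE : 0 ≤ 2 / (θ ^ 2) ^ q * ((r ^ 2) ^ q * E) := by positivity
  obtain hsmall | hlarge := lt_or_ge L (M * Φ)
  · calc L * Φ ^ q ≤ E * (r ^ 2) ^ q := by
          gcongr
          exact hsmall.le.trans (le_trans (by gcongr) hME)
      _ ≤ _ := by linarith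
  obtain hΦz | hΦpos := hΦ0.eq_or_lt
  · have hq0 : q ≠ 0 := by
      rintro rfl
      push_cast at hq
      nlinarith [Nat.cast_nonneg (α := ℝ) n]
    rw [← hΦz, zero_pow hq0, mul_zero]
    positivity
  set δ := √Φ with hδ
  have hδ0 : 0 < δ := Real.sqrt_pos.2 hΦpos
  have hδ2 : δ ^ 2 = Φ := Real.sq_sqrt hΦ0
  have hδx : δ ≤ b - ‖x₁‖ := Real.sqrt_le_iff.2 ⟨by linarith, hΦx⟩
  have hnear : ∀ y s, ‖y - x₁‖ ≤ δ / 2 → s ∈ Icc (t₁ - (δ / 4) ^ 2) t₁ → u y s ≤ 4 ^ q * L := by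
    intro y s hy hs
    have hyn := norm_le_norm_add_norm_sub' y x₁
    have hs1 : t₁ - Φ / 16 ≤ s := by have := hs.1; rw [div_pow, hδ2] at this; linarith
    have hyK : (y, s) ∈ K := (hKmem y s).2 ⟨by linarith, by linarith, hs.2.trans ht₁'⟩
    have hw : Φ / 4 ≤ cylinderWeight b y s := by
      refine le_min ?_ (by linarith)
      have : (δ / 2) ^ 2 ≤ (b - ‖y‖) ^ 2 := by gcongr; linarith
      rw [div_pow, hδ2] at this
      linarith
    have hus := hu.nonneg y s (hKR y s hyK).1 (Ioo_subset_Icc_self (hKR y s hyK).2)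
    have h1 : u y s * (Φ / 4) ^ q ≤ L * Φ ^ q := le_trans (by gcongr) (hmax' y s hyK)
    rw [div_pow, ← mul_div_assoc, div_le_iff₀ (by positivity)] at h1
    have h2 : 0 < Φ ^ q := by positivity
    exact le_of_mul_le_mul_right (by linarith) h2
  have hball := fun y hy => hu.half_le_of_le_mul hM (A := 4 ^ q) (δ := δ) (t₁ := t₁) (x₁ := x₁)
    (x := y) hδ0 (by linarith) (by rw [div_pow, hδ2]; linarith) ht₁R.2 hG hθ0 hθ4 hGθ
    (by rw [hδ2]; exact hlarge) hnear hy
  have hfin := hu.le_apply_zero_of_le_on_ball hM (ρ := θ * δ) hr hrR (by positivity)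
    (div_nonneg hL0 two_pos.le) (x₁ := x₁) (by nlinarith) (by linarith) ht₁' hq hball
  rw [mul_pow θ δ, hδ2, mul_pow (θ ^ 2)] at hfin
  have hθq : 0 < (θ ^ 2) ^ q := by positivity
  calc L * Φ ^ q = 2 / (θ ^ 2) ^ q * (L / 2 * ((θ ^ 2) ^ q * Φ ^ q)) := by field_simp
    _ ≤ 2 / (θ ^ 2) ^ q * ((r ^ 2) ^ q * E) := by gcongr
    _ ≤ _ := by linarith [show 0 ≤ (r ^ 2) ^ q * E by positivity]

/-- Harnack and gradient estimate at a fixed scale. -/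
theorem exists_gradient_estimate (n : ℕ) :
    ∃ C : ℝ, 0 < C ∧ ∀ (R M r : ℝ) (u : EuclideanSpace ℝ (Fin n) → ℝ → ℝ),
      IsApproxCaloric R M u → 0 < M → 0 < r → r ≤ R →
      ∀ x t, ‖x‖ < r / √3 → t ∈ Ioo (-(2 / 3) * r ^ 2) (-(1 / 3) * r ^ 2) →
        ‖fderiv ℝ (fun z => u z t) x‖ + u x t / r ≤ C * (u 0 0 / r + M * r) := by
  obtain ⟨q, hq⟩ : ∃ q : ℕ, 25 * (21 + 4 * (n : ℝ)) ^ 2 ≤ 2 * ((q : ℝ) + 2) :=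
    ⟨13 * (21 + 4 * n) ^ 2, by push_cast; nlinarith [sq_nonneg (21 + 4 * (n : ℝ))]⟩
  obtain ⟨C, hC, h⟩ := exists_weighted_harnack n q hq
  set C' : ℝ := 20 ^ q * C with hC'
  refine ⟨n / 10 + (20 * n * (n + 1) + 1) * (2 * C'), by positivity, ?_⟩
  intro R M r u hu hM hr hrR x t hx ht
  have hr2 : 0 < r ^ 2 := by positivity
  have hrR2 : r ^ 2 ≤ R ^ 2 := by gcongr
  have hR : 0 < R := hr.trans_le hrR
  have hu00 : 0 ≤ u 0 0 := hu.nonneg 0 0 (by simpa using hR) ⟨by nlinarith, le_rfl⟩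
  have hx' : ‖x‖ < 58 / 100 * r := by
    refine hx.trans_le ?_
    have h3 : 1725 / 1000 ≤ √3 := Real.le_sqrt_of_sq_le (by norm_num)
    rw [div_le_iff₀ (by positivity)]
    nlinarith
  have hS : ∀ y s, ‖y - x‖ ≤ r / 20 → s ∈ Icc (t - (r / 20) ^ 2) t →
      u y s ≤ C' * (u 0 0 + 2 * M * r ^ 2) := by
    intro y s hy hs
    have hyn := norm_le_norm_add_norm_sub' y x
    have hs1 := hs.1
    have hs2 := hs.2
    have ht1 := ht.1
    have ht2 := ht.2
    have hw : r ^ 2 / 20 ≤ cylinderWeight (9 / 10 * r) y s := by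
      refine le_min ?_ (by nlinarith)
      have : (27 / 100 * r) ^ 2 ≤ (9 / 10 * r - ‖y‖) ^ 2 := by gcongr; linarith
      nlinarith
    have hus : 0 ≤ u y s := hu.nonneg y s (by linarith) ⟨by nlinarith, by nlinarith⟩
    have h1 := h R M r u hu hM hr hrR y s (by linarith) ⟨by nlinarith, by linarith⟩
    have h2 : u y s * (r ^ 2 / 20) ^ q ≤ C * ((r ^ 2) ^ q * (u 0 0 + 2 * M * r ^ 2)) :=
      le_trans (by gcongr) h1
    rw [div_pow, ← mul_div_assoc, div_le_iff₀ (by positivity)] at h2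
    have h3 : 0 < (r ^ 2) ^ q := by positivity
    refine le_of_mul_le_mul_right ?_ h3
    rw [hC']
    linarith
  have hgrad := hu.norm_fderiv_le hM (x₀ := x) (t₀ := t) (d := r / 20) (by positivity)
    (by linarith) (by nlinarith [ht.1]) (by linarith [ht.2]) hS
  have hux := hS x t (by simp; positivity) ⟨by nlinarith, le_rfl⟩
  have hur : u x t / r ≤ C' * (u 0 0 + 2 * M * r ^ 2) / r := by gcongr
  have hC'0 : 0 < C' := by positivity
  have hSr : C' * (u 0 0 + 2 * M * r ^ 2) / r ≤ 2 * C' * (u 0 0 / r + M * r) := by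
    have h1 : C' * (u 0 0 + 2 * M * r ^ 2) / r = C' * (u 0 0 / r + 2 * (M * r)) := by field_simp
    have h2 : 0 ≤ C' * (u 0 0 / r) := by positivity
    rw [h1]; linarith
  set W := u 0 0 / r + M * r with hW
  have hMr : M * r ≤ W := le_add_of_nonneg_left (by positivity)
  have hdiv : C' * (u 0 0 + 2 * M * r ^ 2) / (r / 20) =
      20 * (C' * (u 0 0 + 2 * M * r ^ 2) / r) := by field_simp
  calc ‖fderiv ℝ (fun z => u z t) x‖ + u x t / r
      ≤ n * (2 * M * (r / 20) + (n + 1) * (20 * (2 * C' * W))) + 2 * C' * W := by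
        refine add_le_add (hgrad.trans ?_) (hur.trans hSr)
        rw [hdiv]
        gcongr
    _ = n / 10 * (M * r) + (20 * n * (n + 1) + 1) * (2 * C') * W := by ring
    _ ≤ n / 10 * W + (20 * n * (n + 1) + 1) * (2 * C') * W := by gcongr
    _ = _ := by ring

end IsApproxCaloric

/-- Theorem 1: interior gradient estimate for nonnegative approximate
solutions of the heat equation on the parabolic cylinder
`B_R = {(x,t) : |x| < R, -R² ≤ t ≤ 0}`, on the sets
`A_r = {(x,t) : -(2/3)r² < t < -(1/3)r², |x| < r/√3}`. -/
theorem parabolic_gradient_estimate (n : ℕ) :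
    ∃ Cbar : ℝ, 0 < Cbar ∧
      ∀ (R M : ℝ), 0 < R → 0 < M →
      ∀ u : EuclideanSpace ℝ (Fin n) → ℝ → ℝ,
      (∀ x t, ‖x‖ < R → t ∈ Icc (-R ^ 2) (0 : ℝ) → 0 ≤ u x t) →
      ContinuousOn (fun p : EuclideanSpace ℝ (Fin n) × ℝ => u p.1 p.2)
        {p | ‖p.1‖ < R ∧ p.2 ∈ Icc (-R ^ 2) (0 : ℝ)} →
      (∀ t ∈ Ioo (-R ^ 2) (0 : ℝ), ContDiffOn ℝ 2 (fun x => u x t) (Metric.ball 0 R)) →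
      (∀ x : EuclideanSpace ℝ (Fin n), ‖x‖ < R →
        ContDiffOn ℝ 1 (fun t => u x t) (Ioo (-R ^ 2) 0)) →
      (∀ x t, ‖x‖ < R → t ∈ Ioo (-R ^ 2) (0 : ℝ) →
        |deriv (fun s => u x s) t - spatialLaplacian u x t| ≤ M) →
      ((Real.sqrt (u 0 0 / M) ≤ R →
          ∀ x t, ‖x‖ < Real.sqrt (u 0 0 / M) / Real.sqrt 3 →
            t ∈ Ioo (-(2 / 3) * Real.sqrt (u 0 0 / M) ^ 2)
                    (-(1 / 3) * Real.sqrt (u 0 0 / M) ^ 2) →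
            ‖fderiv ℝ (fun z => u z t) x‖ + u x t / Real.sqrt (u 0 0 / M)
              ≤ Cbar * Real.sqrt (u 0 0 * M)) ∧
      (R < Real.sqrt (u 0 0 / M) →
          ∀ x t, ‖x‖ < R / Real.sqrt 3 →
            t ∈ Ioo (-(2 / 3) * R ^ 2) (-(1 / 3) * R ^ 2) →
            ‖fderiv ℝ (fun z => u z t) x‖ + u x t / R
              ≤ Cbar * (u 0 0 / R + M * R))) := by
  obtain ⟨C, hC, h⟩ := IsApproxCaloric.exists_gradient_estimate n
  refine ⟨2 * C, by positivity, ?_⟩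
  intro R M hR hM u hnonneg hcont hspace htime hheat
  have hu : IsApproxCaloric R M u := ⟨hnonneg, hcont, hspace, htime, hheat⟩
  have hu00 : 0 ≤ u 0 0 := hu.nonneg 0 0 (by simpa using hR) ⟨by nlinarith, le_rfl⟩
  constructor
  · intro hrR x t hx ht
    set r := √(u 0 0 / M) with hr
    have hr0 : 0 < r := by
      by_contra! hr0
      exact absurd ((norm_nonneg x).trans_lt hx)
        (not_lt.2 (div_nonpos_of_nonpos_of_nonneg hr0 (Real.sqrt_nonneg 3)))
    have hr2 : u 0 0 = M * r ^ 2 := by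
      rw [hr, Real.sq_sqrt (by positivity)]
      field_simp
    have hsqrt : √(u 0 0 * M) = M * r := by
      rw [hr2, show M * r ^ 2 * M = (M * r) ^ 2 by ring, Real.sqrt_sq (by positivity)]
    have hdiv : u 0 0 / r = M * r := by
      rw [hr2]
      field_simp
    have h1 := h R M r u hu hM hr0 hrR x t hx ht
    rw [hdiv] at h1
    rw [hsqrt]
    linarith
  · intro _ x t hx ht
    have h1 := h R M R u hu hM hR le_rfl x t hx ht
    have h2 : 0 ≤ C * (u 0 0 / R + M * R) := by positivity
    linarith
end

section
/- Write points of ℝⁿ×ℝ as (x,y,t) with x ∈ ℝ^{n−1}, y ∈ ℝ. Let G = {(x,y,t) : t < 0, y − |x|² + √(−t) > 0} and ρ > 0, and suppose u is continuous on closure(G) ∩ {|x|² + y² + |t| < ρ}, positive there except at the origin, u(0,0,0) = 0, u is C² in (x,y) and C¹ in t on G ∩ {|x|² + y² + |t| < ρ}, and ∂ₜu − Δu ≥ 0 there. Then the function t ↦ u(0,0,t) is not Hölder continuous at t = 0 with any exponent α > 1/2; that is, for every α > 1/2 and every C > 0 there exist t < 0 arbitrarily close to 0 with u(0,0,t) >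 C·(−t)^α. In particular, t ↦ u(0,0,t) is not C¹ at the origin. -/
open Set Filter

/-- Laplacian of `u = u(x,y,t)` in the space variables `(x,y)`,
`x ∈ ℝ^{n-1}`, `y ∈ ℝ`. -/
noncomputable def lapXY {m : ℕ} (u : EuclideanSpace ℝ (Fin m) → ℝ → ℝ → ℝ)
    (x : EuclideanSpace ℝ (Fin m)) (y t : ℝ) : ℝ :=
  (∑ i, fderiv ℝ (fun z => fderiv ℝ (fun w => u w y t) z (EuclideanSpace.single i 1)) x
      (EuclideanSpace.single i 1))
    + deriv (fun w => deriv (fun w' => u x w' t) w) y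

/-- The region `G = {(x,y,t) : t < 0, y - |x|² + √(-t) > 0}`, whose parabolic boundary
`-t = (y - |x|²)²` is tangent to the `y`-direction at the origin. -/
noncomputable def tangentG (m : ℕ) : Set (EuclideanSpace ℝ (Fin m) × ℝ × ℝ) :=
  {p | p.2.2 < 0 ∧ 0 < p.2.1 - ‖p.1‖ ^ 2 + Real.sqrt (-p.2.2)}

/-- The neighbourhood `{|x|² + y² + |t| < ρ}` of the origin. -/
def originNbhd (m : ℕ) (ρ : ℝ) : Set (EuclideanSpace ℝ (Fin m) × ℝ × ℝ) :=
  {p | ‖p.1‖ ^ 2 + p.2.1 ^ 2 + |p.2.2| < ρ}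

open Topology in
/-- Second-order necessary condition for a local minimum, up to a quadratic perturbation. -/
theorem neg_two_mul_le_deriv_deriv_of_isLocalMin_add_quadratic {f : ℝ → ℝ} {a b c : ℝ}
    (hf : ContDiffAt ℝ 2 f a) (hmin : IsLocalMin (fun s => f s + (b * s + c * s ^ 2)) a) :
    -2 * c ≤ deriv (deriv f) a := by
  set g : ℝ → ℝ := fun s => f s + (b * s + c * s ^ 2) with hg
  have hq : ∀ s : ℝ, HasDerivAt (fun s : ℝ => b * s + c * s ^ 2) (b + 2 * c * s) s := fun s => by
    have h := ((hasDerivAt_id s).const_mul b).add (((hasDerivAt_id s).pow 2).const_mul c)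
    refine h.congr_deriv ?_
    simp
    ring
  have hderiv : deriv g =ᶠ[𝓝 a] fun s => deriv f s + (b + 2 * c * s) := by
    filter_upwards [hf.eventually (by simp)] with s hs
    exact ((hs.differentiableAt (by simp)).hasDerivAt.add (hq s)).deriv
  have hf' : DifferentiableAt ℝ (deriv f) a :=
    ((hf.fderiv_right (m := 1) (by norm_num)).differentiableAt (by simp)).clm_apply
      (differentiableAt_const 1)
  have hderiv2 : deriv (deriv g) a = deriv (deriv f) a + 2 * c := by
    rw [hderiv.deriv_eq]
    have h := ((hasDerivAt_id a).const_mul (2 * c)).const_add b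
    exact (hf'.hasDerivAt.add h).deriv.trans (by simp)
  by_contra! hlt
  have hneg : deriv (deriv g) a < 0 := by linarith
  have hga : ContinuousAt g a := hf.continuousAt.add (hq a).continuousAt
  have hmax : IsLocalMax g a :=
    isLocalMax_of_deriv_deriv_neg hneg hmin.deriv_eq_zero hga
  have hconst : g =ᶠ[𝓝 a] fun _ => g a := by
    filter_upwards [hmin, hmax] with s h1 h2
    exact le_antisymm h2 h1
  have h1 : deriv g =ᶠ[𝓝 a] fun _ => 0 := by
    simpa using hconst.deriv
  rw [h1.deriv_eq] at hneg
  simp at hneg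

/-- The second directional derivative is the second derivative along the line. -/
theorem deriv_deriv_comp_line {E : Type*} [NormedAddCommGroup E] [NormedSpace ℝ E]
    {F : E → ℝ} {x : E} (hF : ContDiffAt ℝ 2 F x) (e : E) :
    deriv (deriv fun s : ℝ => F (x + s • e)) 0 =
      fderiv ℝ (fun z => fderiv ℝ F z e) x e := by
  have hline : ∀ s : ℝ, HasDerivAt (fun s : ℝ => x + s • e) e s := fun s => by
    simpa using ((hasDerivAt_id s).smul_const e).const_add x
  have h0 : x + (0 : ℝ) • e = x := by simp
  have hev : (deriv fun s : ℝ => F (x + s • e)) =ᶠ[nhds 0] fun s => fderiv ℝ F (x + s • e) e := by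
    have ht : Tendsto (fun s : ℝ => x + s • e) (nhds 0) (nhds x) := by
      simpa [h0] using (hline 0).continuousAt.tendsto
    filter_upwards [ht.eventually (hF.eventually (by simp))] with s hs
    exact ((hs.differentiableAt (by simp)).hasFDerivAt.comp_hasDerivAt s (hline s)).deriv
  rw [hev.deriv_eq]
  have hd : DifferentiableAt ℝ (fun z => fderiv ℝ F z e) x :=
    ((hF.fderiv_right (m := 1) (by norm_num)).differentiableAt (by simp)).clm_apply
      (differentiableAt_const e)
  have hd' : HasFDerivAt (fun z => fderiv ℝ F z e) (fderiv ℝ (fun z => fderiv ℝ F z e) x)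
      (x + (0 : ℝ) • e) := by
    rw [h0]; exact hd.hasFDerivAt
  exact (hd'.comp_hasDerivAt (0 : ℝ) (hline 0)).deriv

theorem HasDerivAt.nonpos_of_eventually_le_left {g : ℝ → ℝ} {g' a : ℝ} (hg : HasDerivAt g g' a)
    (hmin : ∀ᶠ s in nhdsWithin a (Iio a), g a ≤ g s) : g' ≤ 0 := by
  have h := (hasDerivWithinAt_iff_tendsto_slope' (s := Iio a) (by simp)).1 hg.hasDerivWithinAt
  refine le_of_tendsto h ?_
  filter_upwards [hmin, self_mem_nhdsWithin] with s h1 h2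
  rw [slope_def_field]
  exact div_nonpos_of_nonneg_of_nonpos (by linarith) (by simpa using (le_of_lt h2))

/-- The defining function of `tangentG`, which serves as a strict subsolution. -/
noncomputable def tangentBarrier {m : ℕ} (p : EuclideanSpace ℝ (Fin m) × ℝ × ℝ) : ℝ :=
  p.2.1 - ‖p.1‖ ^ 2 + √(-p.2.2)

theorem continuous_tangentBarrier (m : ℕ) :
    Continuous (tangentBarrier : EuclideanSpace ℝ (Fin m) × ℝ × ℝ → ℝ) := by
  unfold tangentBarrier
  fun_prop

theorem isOpen_tangentG (m : ℕ) : IsOpen (tangentG m) := by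
  have h : IsOpen {p : EuclideanSpace ℝ (Fin m) × ℝ × ℝ | p.2.2 < 0} :=
    isOpen_lt (by fun_prop) continuous_const
  exact h.inter (isOpen_lt continuous_const (continuous_tangentBarrier m))

theorem isOpen_originNbhd (m : ℕ) (ρ : ℝ) : IsOpen (originNbhd m ρ) :=
  isOpen_lt (by fun_prop) continuous_const

theorem mem_closure_tangentG {m : ℕ} {p : EuclideanSpace ℝ (Fin m) × ℝ × ℝ}
    (ht : p.2.2 ≤ 0) (hv : 0 ≤ tangentBarrier p) : p ∈ closure (tangentG m) := by
  have hlim : Tendsto (fun δ : ℝ => (p.1, p.2.1 + δ, p.2.2 - δ)) (nhdsWithin 0 (Ioi 0))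
      (nhds p) := by
    have hc : Continuous (fun δ : ℝ => (p.1, p.2.1 + δ, p.2.2 - δ)) := by fun_prop
    simpa using (hc.tendsto 0).mono_left nhdsWithin_le_nhds
  refine mem_closure_of_tendsto hlim ?_
  filter_upwards [self_mem_nhdsWithin] with δ hδ
  have hδ : 0 < δ := hδ
  have hs : √(-p.2.2) ≤ √(-(p.2.2 - δ)) := Real.sqrt_le_sqrt (by linarith)
  unfold tangentBarrier at hv
  exact ⟨by simp only; linarith, by simp only; linarith⟩

theorem isCompact_tangent_cap (m : ℕ) (r τ : ℝ) :
    IsCompact {p : EuclideanSpace ℝ (Fin m) × ℝ × ℝ |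
      p.2.2 ≤ τ ∧ 0 ≤ tangentBarrier p ∧ ‖p.1‖ ^ 2 + p.2.1 ^ 2 + |p.2.2| ≤ r} := by
  refine Metric.isCompact_of_isClosed_isBounded ?_ ?_
  · have h1 : IsClosed {p : EuclideanSpace ℝ (Fin m) × ℝ × ℝ | p.2.2 ≤ τ} :=
      isClosed_le (by fun_prop) continuous_const
    have h2 : IsClosed {p : EuclideanSpace ℝ (Fin m) × ℝ × ℝ |
        ‖p.1‖ ^ 2 + p.2.1 ^ 2 + |p.2.2| ≤ r} := isClosed_le (by fun_prop) continuous_const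
    exact h1.inter ((isClosed_le continuous_const (continuous_tangentBarrier m)).inter h2)
  · refine (Metric.isBounded_closedBall (x := 0) (r := r + 1)).subset ?_
    rintro ⟨x, y, t⟩ ⟨-, -, h⟩
    simp only at h
    have h1 := abs_nonneg t
    rw [mem_closedBall_zero_iff, Prod.norm_def, Prod.norm_def]
    refine max_le ?_ (max_le ?_ ?_)
    · nlinarith [sq_nonneg (‖x‖ - 1), sq_nonneg y]
    · rw [Real.norm_eq_abs]
      nlinarith [sq_nonneg (|y| - 1), sq_nonneg ‖x‖, sq_abs y]
    · rw [Real.norm_eq_abs]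
      simp only
      nlinarith [sq_nonneg ‖x‖, sq_nonneg y]

/-- A supersolution cannot be touched from below, up to a constant and backwards in time, by a
positive multiple of `tangentBarrier` at a point of `tangentG` close to time zero. -/
theorem not_touch_tangentBarrier {m : ℕ} {u : EuclideanSpace ℝ (Fin m) → ℝ → ℝ → ℝ}
    {x : EuclideanSpace ℝ (Fin m)} {y t ε : ℝ} (hε : 0 < ε) (ht : t < 0)
    (hsmall : 4 * m * √(-t) < 1)
    (hregxy : ContDiffAt ℝ 2 (fun q : EuclideanSpace ℝ (Fin m) × ℝ => u q.1 q.2 t) (x, y))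
    (hregt : DifferentiableAt ℝ (fun s => u x y s) t)
    (hsuper : 0 ≤ deriv (fun s => u x y s) t - lapXY u x y t)
    (hmin : ∀ᶠ p in nhds (x, y, t), p.2.2 ≤ t →
      u x y t - ε * tangentBarrier (x, y, t) ≤ u p.1 p.2.1 p.2.2 - ε * tangentBarrier p) :
    False := by
  have hspace : ∀ q : ℝ → EuclideanSpace ℝ (Fin m) × ℝ, ∀ a : ℝ, ContinuousAt q a → q a = (x, y) →
      ∀ᶠ s in nhds a, u x y t - ε * tangentBarrier (x, y, t) ≤
        u (q s).1 (q s).2 t - ε * tangentBarrier ((q s).1, (q s).2, t) := by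
    intro q a hq hqa
    have hc : Tendsto (fun s => ((q s).1, (q s).2, t)) (nhds a) (nhds (x, y, t)) := by
      have h : ContinuousAt (fun s => ((q s).1, (q s).2, t)) a := by fun_prop
      simpa [ContinuousAt, hqa] using h
    filter_upwards [hc.eventually hmin] with s hs
    exact hs le_rfl
  have hyy : 0 ≤ deriv (fun w => deriv (fun w' => u x w' t) w) y := by
    have hc : ContDiffAt ℝ 2 (fun w => u x w t) y :=
      hregxy.comp y (contDiffAt_const.prodMk contDiffAt_id)
    have := neg_two_mul_le_deriv_deriv_of_isLocalMin_add_quadratic (b := -ε) (c := 0) hc (by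
      filter_upwards [hspace (fun s => (x, s)) y (by fun_prop) rfl] with s hs
      simp only [tangentBarrier] at hs
      linarith)
    simpa using this
  have hxx : ∀ i, -2 * ε ≤
      fderiv ℝ (fun z => fderiv ℝ (fun w => u w y t) z (EuclideanSpace.single i 1)) x
        (EuclideanSpace.single i 1) := by
    intro i
    have hF : ContDiffAt ℝ 2 (fun w => u w y t) x :=
      hregxy.comp x (contDiffAt_id.prodMk contDiffAt_const)
    rw [← deriv_deriv_comp_line hF]
    have hq : ContDiffAt ℝ 2
        (fun s : ℝ => u (x + s • EuclideanSpace.single i (1 : ℝ)) y t) 0 := by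
      refine ContDiffAt.comp (g := fun w => u w y t) (0 : ℝ) (by simpa using hF) ?_
      fun_prop
    refine neg_two_mul_le_deriv_deriv_of_isLocalMin_add_quadratic
      (b := 2 * ε * inner ℝ x (EuclideanSpace.single i 1)) hq ?_
    filter_upwards [hspace (fun s => (x + s • EuclideanSpace.single i 1, y)) 0
      (by fun_prop) (by simp)] with s hs
    simp only [tangentBarrier, norm_add_sq_real, norm_smul, inner_smul_right,
      PiLp.norm_single, norm_one, Real.norm_eq_abs, mul_one, sq_abs] at hs
    simp only [zero_smul, add_zero]
    linarith
  have htt : deriv (fun s => u x y s) t + ε / (2 * √(-t)) ≤ 0 := by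
    have hsq : HasDerivAt (fun s : ℝ => √(-s)) (-1 / (2 * √(-t))) t :=
      (hasDerivAt_neg t).sqrt (by linarith)
    have hd := hregt.hasDerivAt.sub ((hsq.const_add (y - ‖x‖ ^ 2)).const_mul ε)
    have := hd.nonpos_of_eventually_le_left (by
      have hc : Tendsto (fun s : ℝ => (x, y, s)) (nhdsWithin t (Iio t)) (nhds (x, y, t)) :=
        (Continuous.tendsto (by fun_prop) t).mono_left nhdsWithin_le_nhds
      filter_upwards [hc.eventually hmin, self_mem_nhdsWithin] with s hs hst
      exact hs (le_of_lt hst))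
    have he : ε * (-1 / (2 * √(-t))) = -(ε / (2 * √(-t))) := by ring
    linarith
  have hsum : (m : ℝ) * (-2 * ε) ≤
      ∑ i, fderiv ℝ (fun z => fderiv ℝ (fun w => u w y t) z (EuclideanSpace.single i 1)) x
        (EuclideanSpace.single i 1) := by
    simpa using Finset.card_nsmul_le_sum Finset.univ _ _ fun i _ => hxx i
  unfold lapXY at hsuper
  have hs0 : 0 < √(-t) := Real.sqrt_pos.2 (by linarith)
  have hlt : (m : ℝ) * 2 * ε < ε / (2 * √(-t)) := by
    rw [lt_div_iff₀ (by positivity)]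
    nlinarith
  linarith

/-- Linear growth of a positive supersolution with respect to `tangentBarrier`. -/
theorem exists_mul_sqrt_le_of_supersolution (m : ℕ) (ρ : ℝ) (hρ : 0 < ρ)
    (u : EuclideanSpace ℝ (Fin m) → ℝ → ℝ → ℝ)
    (hcont : ContinuousOn (fun p : EuclideanSpace ℝ (Fin m) × ℝ × ℝ => u p.1 p.2.1 p.2.2)
      (closure (tangentG m) ∩ originNbhd m ρ))
    (hpos : ∀ p ∈ (closure (tangentG m) ∩ originNbhd m ρ) \ {(0, 0, 0)},
      0 < u p.1 p.2.1 p.2.2)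
    (hregxy : ∀ p ∈ tangentG m ∩ originNbhd m ρ,
      ContDiffAt ℝ 2 (fun q : EuclideanSpace ℝ (Fin m) × ℝ => u q.1 q.2 p.2.2) (p.1, p.2.1))
    (hregt : ∀ p ∈ tangentG m ∩ originNbhd m ρ,
      ContDiffAt ℝ 1 (fun s => u p.1 p.2.1 s) p.2.2)
    (hsuper : ∀ p ∈ tangentG m ∩ originNbhd m ρ,
      0 ≤ deriv (fun s => u p.1 p.2.1 s) p.2.2 - lapXY u p.1 p.2.1 p.2.2) :
    ∃ ε > 0, ∃ r > 0, ∀ t : ℝ, t < 0 → -r < t → ε * √(-t) ≤ u 0 0 t := by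
  obtain ⟨r, hr0, hrρ, hr1⟩ : ∃ r : ℝ, 0 < r ∧ r < ρ ∧ r ≤ (1 / (4 * (m + 1))) ^ 2 :=
    ⟨min (ρ / 2) ((1 / (4 * (m + 1))) ^ 2), by positivity,
      (min_le_left _ _).trans_lt (by linarith), min_le_right _ _⟩
  have hm : (0 : ℝ) ≤ m := Nat.cast_nonneg m
  have hsqr : ∀ t : ℝ, -t ≤ r → 4 * (m + 1) * √(-t) ≤ 1 := by
    intro t ht
    have h : √(-t) ≤ 1 / (4 * (m + 1)) :=
      Real.sqrt_le_iff.2 ⟨by positivity, ht.trans hr1⟩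
    rw [le_div_iff₀ (by positivity)] at h
    linarith
  have hr_le : r ≤ 1 := by
    refine hr1.trans (pow_le_one₀ (by positivity) ?_)
    rw [div_le_one (by positivity)]
    linarith
  set K : ℝ → Set (EuclideanSpace ℝ (Fin m) × ℝ × ℝ) := fun τ => {p |
      p.2.2 ≤ τ ∧ 0 ≤ tangentBarrier p ∧ ‖p.1‖ ^ 2 + p.2.1 ^ 2 + |p.2.2| ≤ r} with hK
  have hKc : ∀ τ, IsCompact (K τ) := isCompact_tangent_cap m r
  have hKsub : ∀ τ ≤ 0, K τ ⊆ closure (tangentG m) ∩ originNbhd m ρ := fun τ hτ p hp =>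
    ⟨mem_closure_tangentG (hp.1.trans hτ) hp.2.1, hp.2.2.trans_lt hrρ⟩
  obtain ⟨c, hc0, hc⟩ : ∃ c, 0 < c ∧ ∀ p ∈ K 0 ∩ {p | r ≤ ‖p.1‖ ^ 2 + p.2.1 ^ 2 + |p.2.2|},
      c ≤ u p.1 p.2.1 p.2.2 := by
    refine IsCompact.exists_forall_le'
      (f := fun p : EuclideanSpace ℝ (Fin m) × ℝ × ℝ => u p.1 p.2.1 p.2.2)
      ((hKc 0).inter_right (isClosed_le continuous_const (by fun_prop)))
      (hcont.mono (inter_subset_left.trans (hKsub 0 le_rfl))) ?_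
    rintro p ⟨hp, hpr⟩
    refine hpos p ⟨hKsub 0 le_rfl hp, ?_⟩
    rintro rfl
    simp at hpr
    linarith
  refine ⟨c / 2, by positivity, r, hr0, fun τ hτ hτr => ?_⟩
  have hτK : ((0, 0, τ) : EuclideanSpace ℝ (Fin m) × ℝ × ℝ) ∈ K τ :=
    ⟨le_rfl, by simp [tangentBarrier], by simp [abs_of_neg hτ]; linarith⟩
  obtain ⟨⟨x, y, t⟩, hp, hmin⟩ := (hKc τ).exists_isMinOn ⟨_, hτK⟩
    ((hcont.mono (hKsub τ hτ.le)).sub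
      ((continuous_tangentBarrier m).const_mul (c / 2)).continuousOn)
  suffices h : 0 ≤ u x y t - c / 2 * tangentBarrier (x, y, t) by
    have h2 := h.trans (hmin hτK)
    simp [tangentBarrier] at h2
    exact h2
  by_contra! hneg
  have htτ : t ≤ τ := hp.1
  have ht0 : t < 0 := htτ.trans_lt hτ
  have hv0 : 0 ≤ tangentBarrier (x, y, t) := hp.2.1
  have hN : ‖x‖ ^ 2 + y ^ 2 + |t| ≤ r := hp.2.2
  rw [abs_of_neg ht0] at hN
  have htr : -t ≤ r := by nlinarith [sq_nonneg ‖x‖, sq_nonneg y]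
  have hupos : 0 < u x y t := hpos (x, y, t) ⟨hKsub τ hτ.le hp, by
    simp [ht0.ne]⟩
  have hvpos : 0 < tangentBarrier (x, y, t) := by
    by_contra! h
    have : tangentBarrier (x, y, t) = 0 := le_antisymm h hv0
    rw [this] at hneg
    linarith
  have hpG : (x, y, t) ∈ tangentG m := ⟨ht0, hvpos⟩
  have hsq := hsqr t htr
  have hNlt : (x, y, t) ∈ originNbhd m r := by
    by_contra hge
    have hge' : r ≤ ‖x‖ ^ 2 + y ^ 2 + |t| := not_lt.1 hge
    have hcu : c ≤ u x y t := hc (x, y, t) ⟨⟨ht0.le, hp.2⟩, hge'⟩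
    have hy : y ≤ 1 := by nlinarith [sq_nonneg ‖x‖, sq_nonneg (y - 1)]
    have hvle : tangentBarrier (x, y, t) ≤ 2 := by
      simp only [tangentBarrier]
      nlinarith [sq_nonneg ‖x‖, Real.sqrt_nonneg (-t)]
    nlinarith
  have hpρ : (x, y, t) ∈ tangentG m ∩ originNbhd m ρ := ⟨hpG, hNlt.trans hrρ⟩
  refine not_touch_tangentBarrier (half_pos hc0) ht0 ?_ (hregxy _ hpρ)
    ((hregt _ hpρ).differentiableAt (by simp)) (hsuper _ hpρ) ?_
  · nlinarith [Real.sqrt_pos.2 (neg_pos.2 ht0)]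
  · filter_upwards [((isOpen_tangentG m).inter (isOpen_originNbhd m r)).mem_nhds ⟨hpG, hNlt⟩]
      with p hp' hpt
    exact hmin ⟨hpt.trans htτ, hp'.1.2.le, le_of_lt hp'.2⟩

/-- A function dominating a multiple of `√(-t)` exceeds any `C (-t) ^ α` with `α > 1 / 2`. -/
theorem exists_mul_rpow_lt_of_mul_sqrt_le {g : ℝ → ℝ} {δ r : ℝ} (hδ : 0 < δ) (hr : 0 < r)
    (hg : ∀ t : ℝ, t < 0 → -r < t → δ * √(-t) ≤ g t) {α : ℝ} (hα : 1 / 2 < α) (C : ℝ)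
    {ε : ℝ} (hε : 0 < ε) : ∃ t : ℝ, t < 0 ∧ -ε < t ∧ C * (-t) ^ α < g t := by
  have hlim : Tendsto (fun s : ℝ => C * s ^ (α - 1 / 2)) (nhdsWithin 0 (Ioi 0)) (nhds 0) := by
    have h : ContinuousAt (fun s : ℝ => C * s ^ (α - 1 / 2)) 0 :=
      (Real.continuousAt_rpow_const 0 _ (Or.inr (by linarith))).const_mul C
    have h0 : (0 : ℝ) ^ (α - 1 / 2) = 0 := Real.zero_rpow (by linarith)
    have h' := h.tendsto
    simp only [h0, mul_zero] at h'
    exact h'.mono_left nhdsWithin_le_nhds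
  obtain ⟨s, hs, hs0, hsr⟩ := ((hlim.eventually (gt_mem_nhds hδ)).and
    (Ioo_mem_nhdsGT (lt_min hr hε))).exists
  refine ⟨-s, by linarith, by linarith [hsr.trans_le (min_le_right r ε)], ?_⟩
  refine lt_of_lt_of_le ?_ (hg (-s) (by linarith) (by linarith [hsr.trans_le (min_le_left r ε)]))
  rw [neg_neg, Real.sqrt_eq_rpow, show α = (α - 1 / 2) + 1 / 2 by ring, Real.rpow_add hs0,
    ← mul_assoc]
  exact mul_lt_mul_of_pos_right hs (Real.rpow_pos_of_pos hs0 _)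

/-- loss of regularity in the tangential case: `t ↦ u(0,0,t)` is not
Hölder continuous at `t = 0` with any exponent `α > 1/2`: for every `α > 1/2` and `C > 0`
there are `t < 0` arbitrarily close to `0` with `u(0,0,t) > C(-t)^α`.  In particular
`t ↦ u(0,0,t)` is not `C¹` (not even differentiable from the left) at the origin. -/
theorem parabolic_hopf_tangential_not_holder (m : ℕ) (ρ : ℝ) (hρ : 0 < ρ)
    (u : EuclideanSpace ℝ (Fin m) → ℝ → ℝ → ℝ)
    (hcont : ContinuousOn (fun p : EuclideanSpace ℝ (Fin m) × ℝ × ℝ => u p.1 p.2.1 p.2.2)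
      (closure (tangentG m) ∩ originNbhd m ρ))
    (hpos : ∀ p ∈ (closure (tangentG m) ∩ originNbhd m ρ) \ {(0, 0, 0)},
      0 < u p.1 p.2.1 p.2.2)
    (hzero : u 0 0 0 = 0)
    (hregxy : ∀ p ∈ tangentG m ∩ originNbhd m ρ,
      ContDiffAt ℝ 2 (fun q : EuclideanSpace ℝ (Fin m) × ℝ => u q.1 q.2 p.2.2) (p.1, p.2.1))
    (hregt : ∀ p ∈ tangentG m ∩ originNbhd m ρ,
      ContDiffAt ℝ 1 (fun s => u p.1 p.2.1 s) p.2.2)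
    (hsuper : ∀ p ∈ tangentG m ∩ originNbhd m ρ,
      0 ≤ deriv (fun s => u p.1 p.2.1 s) p.2.2 - lapXY u p.1 p.2.1 p.2.2) :
    (∀ α : ℝ, 1 / 2 < α → ∀ C : ℝ, 0 < C → ∀ ε : ℝ, 0 < ε →
      ∃ t : ℝ, t < 0 ∧ -ε < t ∧ C * (-t) ^ α < u 0 0 t) ∧
    ¬ DifferentiableWithinAt ℝ (fun t => u 0 0 t) (Iic 0) 0 := by
  obtain ⟨δ, hδ, r, hr, hlow⟩ :=
    exists_mul_sqrt_le_of_supersolution m ρ hρ u hcont hpos hregxy hregt hsuper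
  refine ⟨fun α hα C _ ε hε => exists_mul_rpow_lt_of_mul_sqrt_le hδ hr hlow hα C hε, fun hd => ?_⟩
  obtain ⟨C, hC⟩ := hd.isBigO_sub.bound
  rw [eventually_nhdsWithin_iff, Metric.eventually_nhds_iff] at hC
  obtain ⟨η, hη, hC⟩ := hC
  obtain ⟨t, ht, htε, hlt⟩ := exists_mul_rpow_lt_of_mul_sqrt_le hδ hr hlow
    (by norm_num : (1 : ℝ) / 2 < 1) C hη
  have h := hC (y := t) (by simpa [abs_of_neg ht] using (by linarith : -t < η)) ht.le
  rw [hzero, sub_zero, sub_zero, Real.norm_eq_abs, Real.norm_eq_abs, abs_of_neg ht] at h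
  rw [Real.rpow_one] at hlt
  linarith [le_abs_self (u 0 0 t)]
end
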